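/- arXiv:1902.02327 — 7 statements merged into one kernel-verified Lean document; each statement's English description precedes it below -/
import Mathlib

section
/- (Chaganty) Let E₁,E₂ be Polish spaces with their Borel σ-algebras, and let (μₙ) be probability measures on E₁×E₂ with first marginals μ₁ₙ and regular conditional distributions μ₂ₙ(·|x₁), so that μₙ(B₁×B₂)=∫_{B₁} μ₂ₙ(B₂|x₁) μ₁ₙ(dx₁). Assume: (i) (μ₁ₙ) satisfies an LDP on E₁ with good rate function I₁ and speed γ(n); (ii) there is a function J : E₂×E₁ → [0,+∞] such that for each x₁ ∈ E₁, J(·|x₁) is a good rate function on E₂, for every sequence x₁ₙ → x₁ in E₁ the measures (μ₂ₙ(·|x₁ₙ)) satisfy an LDP on E₂ with rate function J(·|x₁) and speed γ(n), and (x₁,x₂) ↦ J(x₂|x₁) is jointly lower semicontinuous. Then: (μₙ) satisfies a weak LDP on E₁×E₂ with speed γ(n) and rate function I(x₁,x₂)=I₁(x₁)+J(x₂|x₁); the second marginals (μ₂ₙ) satisfy an LDP on E₂ with speed γ(n) and rate function I₂(x₂)=inf_{x₁∈E₁} I(x₁,x₂); and if moreover I is a good rate function, then (μₙ) satisfies a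 full LDP with rate I, and I₂ is a good rate function. -/
open MeasureTheory ProbabilityTheory Filter Topology
open scoped ENNReal NNReal

noncomputable section

/-- The unit interval `[0,1]` as a subtype of `ℝ`. -/
abbrev UI : Type := Set.Icc (0:ℝ) 1

/-- `C([0,1],ℝ)`, the continuous real functions on `[0,1]` with the sup-norm. -/
abbrev CC : Type := C(UI, ℝ)

instance : MeasurableSpace CC := borel CC
instance : BorelSpace CC := ⟨rfl⟩

/-- Pairing `⟨λ,h⟩ = ∫₀¹ h dλ` of a finite signed Borel measure on `[0,1]`
with a function `h`. -/
def pairSM (lam : MeasureTheory.SignedMeasure UI) (h : UI → ℝ) : ℝ :=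
  (∫ t, h t ∂lam.toJordanDecomposition.posPart) -
    (∫ t, h t ∂lam.toJordanDecomposition.negPart)

/-- Double integral `∫₀¹∫₀¹ k(t,s) dλ(t) dλ(s)`. -/
def dblInt (lam : MeasureTheory.SignedMeasure UI) (k : UI → UI → ℝ) : ℝ :=
  pairSM lam (fun t => pairSM lam (fun s => k t s))

/-- `Λ_k(λ) = (1/2)∫₀¹∫₀¹ k(t,s) dλ(t)dλ(s)`. -/
def LamK (k : UI → UI → ℝ) (lam : MeasureTheory.SignedMeasure UI) : ℝ :=
  (1/2) * dblInt lam k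

/-- The Cramér transform `Λ*_k(h) = sup_λ (⟨λ,h⟩ − Λ_k(λ)) ∈ [0,∞]`. -/
def CramerK (k : UI → UI → ℝ) (h : UI → ℝ) : ℝ≥0∞ :=
  ⨆ lam : MeasureTheory.SignedMeasure UI, ENNReal.ofReal (pairSM lam h - LamK k lam)

/-- A continuous, symmetric, positive semidefinite kernel on `[0,1]²`. -/
def IsPSDKernel (k : UI → UI → ℝ) : Prop :=
  Continuous (fun p : UI × UI => k p.1 p.2) ∧ (∀ s t, k s t = k t s) ∧
    ∀ (n : ℕ) (t : Fin n → UI) (c : Fin n → ℝ),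
      0 ≤ ∑ i, ∑ j, c i * c j * k (t i) (t j)

/-- Extended logarithm of an extended nonnegative real. -/
def elog (x : ℝ≥0∞) : EReal :=
  if x = 0 then ⊥ else if x = ⊤ then ⊤ else ((Real.log x.toReal : ℝ) : EReal)

/-- Large-deviation lower bound for open sets. -/
def LDPLower {E : Type*} [TopologicalSpace E] [MeasurableSpace E]
    (μ : ℕ → Measure E) (γ : ℕ → ℝ) (I : E → ℝ≥0∞) : Prop :=
  ∀ Θ : Set E, IsOpen Θ →
    -(⨅ x ∈ Θ, (I x : EReal)) ≤
      Filter.atTop.liminf fun n => (((γ n)⁻¹ : ℝ) : EReal) * elog (μ n Θ)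

/-- Large-deviation upper bound for closed sets. -/
def LDPUpper {E : Type*} [TopologicalSpace E] [MeasurableSpace E]
    (μ : ℕ → Measure E) (γ : ℕ → ℝ) (I : E → ℝ≥0∞) : Prop :=
  ∀ Γ : Set E, IsClosed Γ →
    (Filter.atTop.limsup fun n => (((γ n)⁻¹ : ℝ) : EReal) * elog (μ n Γ)) ≤
      -(⨅ x ∈ Γ, (I x : EReal))

/-- Large-deviation upper bound for compact sets. -/
def LDPUpperCompact {E : Type*} [TopologicalSpace E] [MeasurableSpace E]
    (μ : ℕ → Measure E) (γ : ℕ → ℝ) (I : E → ℝ≥0∞) : Prop :=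
  ∀ Γ : Set E, IsCompact Γ →
    (Filter.atTop.limsup fun n => (((γ n)⁻¹ : ℝ) : EReal) * elog (μ n Γ)) ≤
      -(⨅ x ∈ Γ, (I x : EReal))

/-- `(μₙ)` satisfies a large deviation principle with speed `γ` and
(lower semicontinuous) rate function `I`. -/
def LDP {E : Type*} [TopologicalSpace E] [MeasurableSpace E]
    (μ : ℕ → Measure E) (γ : ℕ → ℝ) (I : E → ℝ≥0∞) : Prop :=
  LowerSemicontinuous I ∧ LDPLower μ γ I ∧ LDPUpper μ γ I

/-- `(μₙ)` satisfies a weak large deviation principle with speed `γ` and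
rate function `I` (upper bound only for compact sets). -/
def WLDP {E : Type*} [TopologicalSpace E] [MeasurableSpace E]
    (μ : ℕ → Measure E) (γ : ℕ → ℝ) (I : E → ℝ≥0∞) : Prop :=
  LowerSemicontinuous I ∧ LDPLower μ γ I ∧ LDPUpperCompact μ γ I

/-- A good rate function: lower semicontinuous with compact sublevel sets. -/
def GoodRate {E : Type*} [TopologicalSpace E] (I : E → ℝ≥0∞) : Prop :=
  LowerSemicontinuous I ∧ ∀ a : ℝ≥0, IsCompact {x | I x ≤ (a : ℝ≥0∞)}

/-- A family of random variables satisfies an LDP if the family of their laws does. -/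
def LDPrv {Ω E : Type*} [MeasurableSpace Ω] [TopologicalSpace E] [MeasurableSpace E]
    (P : Measure Ω) (X : ℕ → Ω → E) (γ : ℕ → ℝ) (I : E → ℝ≥0∞) : Prop :=
  LDP (fun n => P.map (X n)) γ I

/-- A family of random variables satisfies a WLDP if the family of their laws does. -/
def WLDPrv {Ω E : Type*} [MeasurableSpace Ω] [TopologicalSpace E] [MeasurableSpace E]
    (P : Measure Ω) (X : ℕ → Ω → E) (γ : ℕ → ℝ) (I : E → ℝ≥0∞) : Prop :=
  WLDP (fun n => P.map (X n)) γ I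

/-- Exponential tightness at speed `γ(n)` of a family of `C([0,1],ℝ)`-valued
random variables. -/
def ExpTight {Ω : Type*} [MeasurableSpace Ω] (P : Measure Ω) (X : ℕ → Ω → CC)
    (γ : ℕ → ℝ) : Prop :=
  ∀ R : ℝ, 0 < R → ∃ K : Set CC, IsCompact K ∧
    (Filter.atTop.limsup fun n => (((γ n)⁻¹ : ℝ) : EReal) * elog (P (X n ⁻¹' Kᶜ))) ≤
      ((-R : ℝ) : EReal)

/-- A real random variable is Gaussian. -/
def IsGaussianRV {Ω : Type*} [MeasurableSpace Ω] (P : Measure Ω) (ξ : Ω → ℝ) : Prop :=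
  ∃ (m : ℝ) (v : ℝ≥0), P.map ξ = gaussianReal m v

/-- A `C([0,1],ℝ)`-valued random variable is a continuous Gaussian process:
`⟨λ,X⟩` is a Gaussian real random variable for every signed measure `λ`. -/
def IsContGaussian {Ω : Type*} [MeasurableSpace Ω] (P : Measure Ω) (X : Ω → CC) : Prop :=
  Measurable X ∧ ∀ lam : MeasureTheory.SignedMeasure UI,
    IsGaussianRV P fun ω => pairSM lam (X ω)

/-- A continuous Gaussian process is centered: `E⟨λ,X⟩ = 0` for all `λ`. -/
def IsCentered {Ω : Type*} [MeasurableSpace Ω] (P : Measure Ω) (X : Ω → CC) : Prop :=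
  ∀ lam : MeasureTheory.SignedMeasure UI, ∫ ω, pairSM lam (X ω) ∂P = 0

/-- `k` is the covariance function of some centered continuous Gaussian process. -/
def IsCovOfCenteredCGP (k : UI → UI → ℝ) : Prop :=
  ∃ (Ω' : Type) (_ : MeasurableSpace Ω') (P' : Measure Ω') (U : Ω' → CC),
    IsProbabilityMeasure P' ∧ IsContGaussian P' U ∧ IsCentered P' U ∧
      ∀ s t : UI, k s t = ∫ ω, U ω s * U ω t ∂P'

/-- Hypothesis (G): `(Xⁿ)` are centered continuous Gaussian processes,
exponentially tight at speed `γ(n)`, with `γ(n)·Var⟨λ,Xⁿ⟩ → ∫∫ k̄ dλdλ`,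
where `k̄` is a continuous symmetric positive semidefinite kernel which is the
covariance of some centered continuous Gaussian process. -/
def HypG {Ω : Type*} [MeasurableSpace Ω] (P : Measure Ω) (X : ℕ → Ω → CC)
    (γ : ℕ → ℝ) (kbar : UI → UI → ℝ) : Prop :=
  (∀ n, IsContGaussian P (X n)) ∧ (∀ n, IsCentered P (X n)) ∧
    ExpTight P X γ ∧ IsPSDKernel kbar ∧ IsCovOfCenteredCGP kbar ∧
    ∀ lam : MeasureTheory.SignedMeasure UI,
      Tendsto (fun n => γ n * variance (fun ω => pairSM lam (X n ω)) P) atTop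
        (nhds (dblInt lam kbar))

/-- `C_α = {y ∈ C([0,1],ℝ) : y(t) ≥ α for all t}`. -/
def Calpha (α : ℝ) : Set CC := {y : CC | ∀ t, α ≤ y t}

/-- The mean function `m(t) = e^{a₁t}(x + (a₀/a₁)(1−e^{−a₁t}))` of the
Ornstein–Uhlenbeck process. -/
def mFun (a0 a1 x : ℝ) (t : UI) : ℝ :=
  Real.exp (a1 * t) * (x + a0 / a1 * (1 - Real.exp (-(a1 * t))))

/-- The covariance kernel `kʸ(s,t) = e^{a₁(s+t)} ∫₀^{s∧t} e^{−2a₁u} y(u)² du`. -/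
def kyFun (a1 : ℝ) (y : CC) (s t : UI) : ℝ :=
  Real.exp (a1 * ((s : ℝ) + (t : ℝ))) *
    ∫ u in (0:ℝ)..(min (s : ℝ) (t : ℝ)),
      Real.exp (-(2 * a1 * u)) * (Set.IccExtend zero_le_one (⇑y) u) ^ 2

/-- The Freidlin–Wentzell rate function
`J(f|y) = (1/2)∫₀¹ ((φ(t) − a₀ − a₁f(t))/y(t))² dt` if `f = x + ∫₀^· φ` for some
`φ ∈ L²[0,1]`, and `+∞` otherwise. -/
def Jfw (a0 a1 x : ℝ) (y f : CC) : ℝ≥0∞ :=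
  ⨅ (φ : ℝ → ℝ) (_ : MemLp φ 2 (volume.restrict (Set.Icc (0:ℝ) 1)))
      (_ : ∀ t : UI, f t = x + ∫ s in (0:ℝ)..(t : ℝ), φ s),
    ENNReal.ofReal ((1/2) * ∫ t in (0:ℝ)..1,
      ((φ t - a0 - a1 * Set.IccExtend zero_le_one (⇑f) t) /
        Set.IccExtend zero_le_one (⇑y) t) ^ 2)


/-- The exponential scale `exp (-(g c))` in `[0,∞]`. -/
def xp (g c : ℝ) : ℝ≥0∞ := ENNReal.ofReal (Real.exp (-(g * c)))

lemma xp_mul (g c d : ℝ) : xp g c * xp g d = xp g (c + d) := by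
  unfold xp
  rw [← ENNReal.ofReal_mul (Real.exp_nonneg _), ← Real.exp_add]
  congr 2; ring

lemma xp_anti {g c d : ℝ} (hg : 0 < g) (h : c ≤ d) : xp g d ≤ xp g c := by
  unfold xp
  apply ENNReal.ofReal_le_ofReal
  apply Real.exp_le_exp.2
  nlinarith

lemma one_le_xp {g c : ℝ} (hg : 0 < g) (h : c ≤ 0) : 1 ≤ xp g c := by
  unfold xp
  rw [ENNReal.one_le_ofReal]
  apply Real.one_le_exp
  nlinarith

lemma xp_ne_top (g c : ℝ) : xp g c ≠ ⊤ := ENNReal.ofReal_ne_top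

lemma scaled_le_iff {g : ℝ} (hg : 0 < g) (m : ℝ≥0∞) (c : ℝ) :
    ((g⁻¹ : ℝ) : EReal) * elog m ≤ ((-c : ℝ) : EReal) ↔ m ≤ xp g c := by
  have hg' : 0 < g⁻¹ := inv_pos.2 hg
  unfold elog xp
  split_ifs with h0 h1
  · simp [h0, EReal.coe_mul_bot_of_pos hg']
  · rw [EReal.coe_mul_top_of_pos hg']
    simp [h1]
  · have hpos : 0 < m.toReal := ENNReal.toReal_pos h0 h1
    rw [← EReal.coe_mul, EReal.coe_le_coe_iff, ENNReal.le_ofReal_iff_toReal_le h1 (Real.exp_nonneg _),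
      ← Real.log_le_iff_le_exp hpos, inv_mul_le_iff₀ hg]
    simp

lemma le_scaled_iff {g : ℝ} (hg : 0 < g) (m : ℝ≥0∞) (c : ℝ) :
    ((-c : ℝ) : EReal) ≤ ((g⁻¹ : ℝ) : EReal) * elog m ↔ xp g c ≤ m := by
  have hg' : 0 < g⁻¹ := inv_pos.2 hg
  unfold elog xp
  split_ifs with h0 h1
  · simp [h0, EReal.coe_mul_bot_of_pos hg', -EReal.coe_neg, Real.exp_pos]
  · rw [EReal.coe_mul_top_of_pos hg']
    simp [h1]
  · have hpos : 0 < m.toReal := ENNReal.toReal_pos h0 h1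
    rw [← EReal.coe_mul, EReal.coe_le_coe_iff, ENNReal.ofReal_le_iff_le_toReal h1,
      ← Real.le_log_iff_exp_le hpos, le_inv_mul_iff₀ hg]
    simp

lemma upper_iff {γ : ℕ → ℝ} (hγ : Tendsto γ atTop atTop) (m : ℕ → ℝ≥0∞) (I : EReal) :
    (Filter.atTop.limsup fun n => (((γ n)⁻¹ : ℝ) : EReal) * elog (m n)) ≤ -I ↔
      ∀ c : ℝ, (c : EReal) < I → ∀ᶠ n in atTop, m n ≤ xp (γ n) c := by
  have hpos := hγ.eventually_gt_atTop 0
  constructor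
  · intro h c hc
    have h1 : (Filter.atTop.limsup fun n => (((γ n)⁻¹ : ℝ) : EReal) * elog (m n))
        < ((-c : ℝ) : EReal) := by
      refine lt_of_le_of_lt h ?_
      rw [EReal.coe_neg]
      exact EReal.neg_lt_neg_iff.2 hc
    filter_upwards [eventually_lt_of_limsup_lt h1, hpos] with n hn hp
    exact (scaled_le_iff hp _ _).1 hn.le
  · intro h
    rw [EReal.le_neg]
    refine EReal.ge_of_forall_gt_iff_ge.1 ?_
    intro c hc
    rw [EReal.le_neg, ← EReal.coe_neg]
    refine limsup_le_of_le (h := ?_)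
    filter_upwards [h c hc, hpos] with n hn hp
    exact (scaled_le_iff hp _ _).2 hn

lemma lower_iff {γ : ℕ → ℝ} (hγ : Tendsto γ atTop atTop) (m : ℕ → ℝ≥0∞) (I : EReal) :
    -I ≤ (Filter.atTop.liminf fun n => (((γ n)⁻¹ : ℝ) : EReal) * elog (m n)) ↔
      ∀ c : ℝ, I < (c : EReal) → ∀ᶠ n in atTop, xp (γ n) c ≤ m n := by
  have hpos := hγ.eventually_gt_atTop 0
  constructor
  · intro h c hc
    have h1 : ((-c : ℝ) : EReal) <
        (Filter.atTop.liminf fun n => (((γ n)⁻¹ : ℝ) : EReal) * elog (m n)) := by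
      refine lt_of_lt_of_le ?_ h
      rw [EReal.coe_neg]
      exact EReal.neg_lt_neg_iff.2 hc
    filter_upwards [eventually_lt_of_lt_liminf h1, hpos] with n hn hp
    exact (le_scaled_iff hp _ _).1 hn.le
  · intro h
    rw [EReal.neg_le]
    refine EReal.le_of_forall_lt_iff_le.1 ?_
    intro c hc
    rw [EReal.neg_le, ← EReal.coe_neg]
    refine le_liminf_of_le (h := ?_)
    filter_upwards [h c hc, hpos] with n hn hp
    exact (le_scaled_iff hp _ _).2 hn

lemma uniform_of_seq {X : Type*} [TopologicalSpace X] [FirstCountableTopology X] (x : X)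
    (P : ℕ → X → Prop)
    (h : ∀ xs : ℕ → X, Tendsto xs atTop (𝓝 x) → ∀ᶠ n in atTop, P n (xs n)) :
    ∃ U : Set X, IsOpen U ∧ x ∈ U ∧ ∀ᶠ n in atTop, ∀ y ∈ U, P n y := by
  obtain ⟨B, hB⟩ := (𝓝 x).exists_antitone_basis
  by_contra hcon
  have h1 : ∀ k, ∃ᶠ n in atTop, ∃ y ∈ B k, ¬ P n y := by
    intro k hk
    apply hcon
    obtain ⟨U, hUB, hU, hxU⟩ := mem_nhds_iff.1 (hB.1.mem_of_mem (i := k) trivial)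
    refine ⟨U, hU, hxU, ?_⟩
    filter_upwards [hk] with n hn y hy
    by_contra hP
    exact hn ⟨y, hUB hy, hP⟩
  obtain ⟨φ, hφ, hy⟩ := extraction_forall_of_frequently h1
  choose y hyB hyP using hy
  have ht : Tendsto (Function.extend φ y (fun _ => x)) atTop (𝓝 x) := by
    rw [hB.1.tendsto_right_iff]
    intro j _
    filter_upwards [eventually_ge_atTop (φ j)] with n hn
    by_cases hex : ∃ k, φ k = n
    · obtain ⟨k, rfl⟩ := hex
      rw [hφ.injective.extend_apply]
      exact hB.2 (hφ.le_iff_le.1 hn) (hyB k)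
    · rw [Function.extend_apply' _ _ _ hex]
      exact mem_of_mem_nhds (hB.1.mem_of_mem (i := j) trivial)
  obtain ⟨N, hN⟩ := eventually_atTop.1 (h _ ht)
  have := hN (φ N) hφ.le_apply
  rw [hφ.injective.extend_apply] at this
  exact hyP N this

lemma nn_lt_ofReal_iff (i : ℝ≥0) (r : ℝ) : (i : ℝ≥0∞) < ENNReal.ofReal r ↔ (i : ℝ) < r := by
  rw [ENNReal.ofReal, ENNReal.coe_lt_coe, Real.lt_toNNReal_iff_coe_lt]

lemma coe_le_ereal_iff (r : ℝ) (a : ℝ≥0∞) : (r : EReal) ≤ (a : EReal) ↔ ENNReal.ofReal r ≤ a := by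
  rw [← EReal.coe_ennreal_le_coe_ennreal_iff, EReal.coe_ennreal_ofReal]
  constructor
  · intro h
    rcases le_total r 0 with h0 | h0
    · rw [max_eq_right h0]; exact EReal.coe_ennreal_nonneg a
    · rwa [max_eq_left h0]
  · intro h
    exact le_trans (EReal.coe_le_coe_iff.2 (le_max_left _ _)) h

lemma ereal_lt_coe_iff (r : ℝ) (a : ℝ≥0∞) : (a : EReal) < (r : EReal) ↔ a < ENNReal.ofReal r := by
  rw [← not_le, coe_le_ereal_iff, not_le]

lemma LDPUpper.bound {E : Type*} [TopologicalSpace E] [MeasurableSpace E]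
    {μ : ℕ → Measure E} {γ : ℕ → ℝ} {I : E → ℝ≥0∞} (hγ : Tendsto γ atTop atTop)
    (h : LDPUpper μ γ I) {Γ : Set E} (hΓ : IsClosed Γ) {c d : ℝ} (hcd : c < d)
    (hd : ∀ x ∈ Γ, ENNReal.ofReal d ≤ I x) : ∀ᶠ n in atTop, μ n Γ ≤ xp (γ n) c := by
  refine (upper_iff hγ (fun n => μ n Γ) _).1 (h Γ hΓ) c ?_
  refine lt_of_lt_of_le (EReal.coe_lt_coe_iff.2 hcd) ?_
  exact le_iInf₂ fun x hx => (coe_le_ereal_iff _ _).2 (hd x hx)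

lemma LDPLower.bound {E : Type*} [TopologicalSpace E] [MeasurableSpace E]
    {μ : ℕ → Measure E} {γ : ℕ → ℝ} {I : E → ℝ≥0∞} (hγ : Tendsto γ atTop atTop)
    (h : LDPLower μ γ I) {Θ : Set E} (hΘ : IsOpen Θ) {c : ℝ} {x : E} (hx : x ∈ Θ)
    (hc : I x < ENNReal.ofReal c) : ∀ᶠ n in atTop, xp (γ n) c ≤ μ n Θ := by
  refine (lower_iff hγ (fun n => μ n Θ) _).1 (h Θ hΘ) c ?_
  exact lt_of_le_of_lt (iInf₂_le x hx) ((ereal_lt_coe_iff _ _).2 hc)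

lemma LDPUpper.of_bound {E : Type*} [TopologicalSpace E] [MeasurableSpace E]
    {μ : ℕ → Measure E} {γ : ℕ → ℝ} {I : E → ℝ≥0∞} (hγ : Tendsto γ atTop atTop)
    (hμ : ∀ n, IsProbabilityMeasure (μ n))
    (h : ∀ Γ : Set E, IsClosed Γ → ∀ c d : ℝ, 0 ≤ c → c < d →
      (∀ x ∈ Γ, ENNReal.ofReal d ≤ I x) → ∀ᶠ n in atTop, μ n Γ ≤ xp (γ n) c) :
    LDPUpper μ γ I := by
  intro Γ hΓ
  refine (upper_iff hγ (fun n => μ n Γ) _).2 fun c hc => ?_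
  rcases lt_or_ge c 0 with h0 | h0
  · filter_upwards [hγ.eventually_gt_atTop 0] with n hn
    exact prob_le_one.trans (one_le_xp hn h0.le)
  · obtain ⟨d, hcd, hd⟩ := EReal.lt_iff_exists_real_btwn.1 hc
    refine h Γ hΓ c d h0 (EReal.coe_lt_coe_iff.1 hcd) fun x hx => ?_
    exact (coe_le_ereal_iff _ _).1 (hd.le.trans (iInf₂_le x hx))

lemma LDPLower.of_bound {E : Type*} [TopologicalSpace E] [MeasurableSpace E]
    {μ : ℕ → Measure E} {γ : ℕ → ℝ} {I : E → ℝ≥0∞} (hγ : Tendsto γ atTop atTop)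
    (h : ∀ Θ : Set E, IsOpen Θ → ∀ x ∈ Θ, ∀ c : ℝ, I x < ENNReal.ofReal c →
      ∀ᶠ n in atTop, xp (γ n) c ≤ μ n Θ) :
    LDPLower μ γ I := by
  intro Θ hΘ
  refine (lower_iff hγ (fun n => μ n Θ) _).2 fun c hc => ?_
  simp only [iInf_lt_iff] at hc
  obtain ⟨x, hx, hxc⟩ := hc
  exact h Θ hΘ x hx c ((ereal_lt_coe_iff _ _).1 hxc)

section core
variable {E1 E2 : Type*} [TopologicalSpace E1] [PolishSpace E1]
    [MeasurableSpace E1] [BorelSpace E1]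
    [TopologicalSpace E2] [PolishSpace E2] [MeasurableSpace E2] [BorelSpace E2]

lemma local_upper
    (μ : ℕ → Measure (E1 × E2)) (γ : ℕ → ℝ) (hγ : Tendsto γ atTop atTop)
    (ν : ℕ → E1 → Measure E2)
    (hdisint : ∀ n (B1 : Set E1) (B2 : Set E2), MeasurableSet B1 → MeasurableSet B2 →
      μ n (B1 ×ˢ B2) = ∫⁻ x1 in B1, ν n x1 B2 ∂(μ n).fst)
    (I1 : E1 → ℝ≥0∞) (hLDP1 : LDP (fun n => (μ n).fst) γ I1)
    (J : E2 → E1 → ℝ≥0∞)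
    (hJcont : ∀ (x1 : E1) (xs : ℕ → E1), Tendsto xs atTop (nhds x1) →
      LDP (fun n => ν n (xs n)) γ fun x2 => J x2 x1)
    (x1 : E1) (hx1 : I1 x1 ≠ ⊤) (F : Set E2) (hF : IsClosed F) (c d : ℝ) (hcd : c < d)
    (hd : ∀ x2 ∈ F, ENNReal.ofReal d ≤ I1 x1 + J x2 x1) :
    ∃ U : Set E1, IsOpen U ∧ x1 ∈ U ∧ ∀ᶠ n in atTop, μ n (U ×ˢ F) ≤ xp (γ n) c := by
  obtain ⟨i, hi⟩ : ∃ i : ℝ≥0, I1 x1 = i := ⟨_, (ENNReal.coe_toNNReal hx1).symm⟩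
  set ε : ℝ := (d - c) / 2 with hε
  have hεpos : 0 < ε := by rw [hε]; linarith
  -- conditional part
  obtain ⟨U2, hU2o, hxU2, hU2⟩ := uniform_of_seq x1
    (fun n y => ν n y F ≤ xp (γ n) (d - i - ε)) (by
      intro xs hxs
      refine LDPUpper.bound hγ (hJcont x1 xs hxs).2.2 hF (d := d - i) (by linarith) ?_
      intro x2 hx2
      rw [ENNReal.ofReal_sub _ i.coe_nonneg, tsub_le_iff_left]
      simpa [hi] using hd x2 hx2)
  -- marginal part
  obtain ⟨C, hCx, hCc, hC⟩ : ∃ C ∈ 𝓝 x1, IsClosed C ∧ ∀ y ∈ C, ENNReal.ofReal (i - ε / 2) ≤ I1 y := by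
    rcases le_or_gt ((i : ℝ) - ε / 2) 0 with h0 | h0
    · exact ⟨Set.univ, univ_mem, isClosed_univ, fun y _ => by simp [ENNReal.ofReal_of_nonpos h0]⟩
    · have hlt : ENNReal.ofReal (i - ε / 2) < I1 x1 := by
        rw [hi, ENNReal.ofReal_lt_coe_iff h0.le]
        linarith
      obtain ⟨C, hCx, hCc, hCs⟩ := exists_mem_nhds_isClosed_subset (hLDP1.1 x1 _ hlt)
      exact ⟨C, hCx, hCc, fun y hy => (hCs hy).le⟩
  have hm := LDPUpper.bound hγ hLDP1.2.2 hCc (c := i - ε) (d := i - ε / 2) (by linarith) hC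
  refine ⟨interior C ∩ U2, isOpen_interior.inter hU2o, ⟨mem_interior_iff_mem_nhds.2 hCx, hxU2⟩, ?_⟩
  filter_upwards [hm, hU2] with n hn1 hn2
  have hmeas : MeasurableSet (interior C ∩ U2) := (isOpen_interior.inter hU2o).measurableSet
  rw [hdisint n _ _ hmeas hF.measurableSet]
  calc ∫⁻ y in interior C ∩ U2, ν n y F ∂(μ n).fst
      ≤ ∫⁻ _ in interior C ∩ U2, xp (γ n) (d - i - ε) ∂(μ n).fst :=
        setLIntegral_mono' hmeas fun y hy => hn2 y hy.2
    _ = xp (γ n) (d - i - ε) * (μ n).fst (interior C ∩ U2) := setLIntegral_const _ _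
    _ ≤ xp (γ n) (d - i - ε) * xp (γ n) (i - ε) := by
        gcongr
        exact (measure_mono (Set.inter_subset_left.trans interior_subset)).trans hn1
    _ = xp (γ n) c := by
        rw [xp_mul]; congr 1; rw [hε]; ring

lemma joint_lower
    (μ : ℕ → Measure (E1 × E2)) (γ : ℕ → ℝ) (hγ : Tendsto γ atTop atTop)
    (ν : ℕ → E1 → Measure E2)
    (hdisint : ∀ n (B1 : Set E1) (B2 : Set E2), MeasurableSet B1 → MeasurableSet B2 →
      μ n (B1 ×ˢ B2) = ∫⁻ x1 in B1, ν n x1 B2 ∂(μ n).fst)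
    (I1 : E1 → ℝ≥0∞) (hLDP1 : LDP (fun n => (μ n).fst) γ I1)
    (J : E2 → E1 → ℝ≥0∞)
    (hJcont : ∀ (x1 : E1) (xs : ℕ → E1), Tendsto xs atTop (nhds x1) →
      LDP (fun n => ν n (xs n)) γ fun x2 => J x2 x1) :
    LDPLower μ γ (fun p : E1 × E2 => I1 p.1 + J p.2 p.1) := by
  refine LDPLower.of_bound hγ ?_
  rintro Θ hΘ ⟨x1, x2⟩ hx c hc
  simp only at hc
  have hfin : I1 x1 + J x2 x1 ≠ ⊤ := (hc.trans ENNReal.ofReal_lt_top).ne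
  obtain ⟨i, hi⟩ : ∃ i : ℝ≥0, I1 x1 = i :=
    ⟨_, (ENNReal.coe_toNNReal (ENNReal.add_ne_top.1 hfin).1).symm⟩
  obtain ⟨j, hj⟩ : ∃ j : ℝ≥0, J x2 x1 = j :=
    ⟨_, (ENNReal.coe_toNNReal (ENNReal.add_ne_top.1 hfin).2).symm⟩
  have hij : (i : ℝ) + j < c := by
    rw [hi, hj, ← ENNReal.coe_add, nn_lt_ofReal_iff] at hc
    simpa using hc
  set ε : ℝ := (c - (i + j)) / 2 with hε
  have hεpos : 0 < ε := by rw [hε]; linarith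
  obtain ⟨U, V, hU, hV, hxU, hxV, hUV⟩ := isOpen_prod_iff.1 hΘ x1 x2 hx
  obtain ⟨U2, hU2o, hxU2, hU2⟩ := uniform_of_seq x1
    (fun n y => xp (γ n) (j + ε) ≤ ν n y V) (by
      intro xs hxs
      refine LDPLower.bound hγ (hJcont x1 xs hxs).2.1 hV hxV ?_
      rw [hj, nn_lt_ofReal_iff]
      linarith)
  have hm := LDPLower.bound hγ hLDP1.2.1 (hU.inter hU2o) (c := i + ε) ⟨hxU, hxU2⟩ (by
      rw [hi, nn_lt_ofReal_iff]
      linarith)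
  filter_upwards [hm, hU2] with n hn1 hn2
  have hmeas : MeasurableSet (U ∩ U2) := (hU.inter hU2o).measurableSet
  calc xp (γ n) c = xp (γ n) (j + ε) * xp (γ n) (i + ε) := by
        rw [xp_mul]; congr 1; rw [hε]; ring
    _ ≤ xp (γ n) (j + ε) * (μ n).fst (U ∩ U2) := by gcongr
    _ = ∫⁻ _ in U ∩ U2, xp (γ n) (j + ε) ∂(μ n).fst := (setLIntegral_const _ _).symm
    _ ≤ ∫⁻ y in U ∩ U2, ν n y V ∂(μ n).fst :=
        setLIntegral_mono' hmeas fun y hy => hn2 y hy.2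
    _ = μ n ((U ∩ U2) ×ˢ V) := (hdisint n _ _ hmeas hV.measurableSet).symm
    _ ≤ μ n Θ := measure_mono ((Set.prod_mono Set.inter_subset_left subset_rfl).trans hUV)

lemma joint_upper
    (μ : ℕ → Measure (E1 × E2)) (hμ : ∀ n, IsProbabilityMeasure (μ n))
    (γ : ℕ → ℝ) (hγ : Tendsto γ atTop atTop)
    (ν : ℕ → E1 → Measure E2)
    (hdisint : ∀ n (B1 : Set E1) (B2 : Set E2), MeasurableSet B1 → MeasurableSet B2 →
      μ n (B1 ×ˢ B2) = ∫⁻ x1 in B1, ν n x1 B2 ∂(μ n).fst)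
    (I1 : E1 → ℝ≥0∞) (hI1good : GoodRate I1) (hLDP1 : LDP (fun n => (μ n).fst) γ I1)
    (J : E2 → E1 → ℝ≥0∞)
    (hJgood : ∀ x1, GoodRate fun x2 => J x2 x1)
    (hJcont : ∀ (x1 : E1) (xs : ℕ → E1), Tendsto xs atTop (nhds x1) →
      LDP (fun n => ν n (xs n)) γ fun x2 => J x2 x1) :
    LDPUpper μ γ (fun p : E1 × E2 => I1 p.1 + J p.2 p.1) := by
  refine LDPUpper.of_bound hγ hμ ?_
  intro Γ hΓ c e hc0 hce he
  obtain ⟨d, hcd, hde⟩ := exists_between hce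
  obtain ⟨b, hcb, hbd⟩ := exists_between hcd
  have hd0 : 0 ≤ d := hc0.trans hcd.le
  have hlocal : ∀ x1 : E1, I1 x1 ≤ ENNReal.ofReal d → ∃ U : Set E1, IsOpen U ∧ x1 ∈ U ∧
      ∀ᶠ n in atTop, μ n (Γ ∩ U ×ˢ Set.univ) ≤ xp (γ n) b := by
    intro x1 hx1
    have hL : IsCompact {x2 | J x2 x1 ≤ ENNReal.ofReal d - I1 x1} := by
      have := (hJgood x1).2 (ENNReal.ofReal d - I1 x1).toNNReal
      rwa [ENNReal.coe_toNNReal (ne_top_of_le_ne_top ENNReal.ofReal_ne_top tsub_le_self)] at this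
    obtain ⟨U, V, hU, hV, hxU, hLV, hUV⟩ := generalized_tube_lemma
      (isCompact_singleton (x := x1)) hL hΓ.isOpen_compl (by
        rintro ⟨y1, y2⟩ ⟨h1, h2⟩ hmem
        simp only [Set.mem_singleton_iff] at h1
        subst h1
        have h3 : I1 y1 + J y2 y1 ≤ ENNReal.ofReal d := by
          have h2' : J y2 y1 ≤ ENNReal.ofReal d - I1 y1 := h2
          calc I1 y1 + J y2 y1 ≤ I1 y1 + (ENNReal.ofReal d - I1 y1) := by gcongr
            _ = ENNReal.ofReal d := add_tsub_cancel_of_le hx1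
        have h4 := (he _ hmem).trans h3
        exact absurd h4 (not_le.2 ((ENNReal.ofReal_lt_ofReal_iff (hd0.trans_lt hde)).2 hde)))
    obtain ⟨U', hU', hxU', hb⟩ := local_upper μ γ hγ ν hdisint I1 hLDP1 J hJcont x1
      (ne_top_of_le_ne_top ENNReal.ofReal_ne_top hx1) Vᶜ hV.isClosed_compl b d hbd (by
        intro x2 hx2
        rw [← tsub_le_iff_left]
        by_contra hcon
        exact hx2 (hLV (not_le.1 hcon).le))
    refine ⟨U ∩ U', hU.inter hU', ⟨hxU rfl, hxU'⟩, ?_⟩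
    filter_upwards [hb] with n hn
    refine (measure_mono ?_).trans hn
    rintro ⟨y1, y2⟩ ⟨hy, ⟨hy1, hy1'⟩, -⟩
    exact ⟨hy1', fun hy2 => hUV (Set.mk_mem_prod hy1 hy2) hy⟩
  have hlocal' : ∀ x1 : E1, ∃ U : Set E1, I1 x1 ≤ ENNReal.ofReal d → IsOpen U ∧ x1 ∈ U ∧
      ∀ᶠ n in atTop, μ n (Γ ∩ U ×ˢ Set.univ) ≤ xp (γ n) b := by
    intro x1
    by_cases h : I1 x1 ≤ ENNReal.ofReal d
    · obtain ⟨U, hU⟩ := hlocal x1 h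
      exact ⟨U, fun _ => hU⟩
    · exact ⟨∅, fun h' => absurd h' h⟩
  choose U hU using hlocal'
  have hK : IsCompact {x | I1 x ≤ ENNReal.ofReal d} := hI1good.2 d.toNNReal
  obtain ⟨t, ht, hcov⟩ := hK.elim_nhds_subcover U
    fun x hx => (hU x hx).1.mem_nhds (hU x hx).2.1
  have hO : IsOpen (⋃ x ∈ t, U x) := isOpen_biUnion fun x hx => (hU x (ht x hx)).1
  have hcompl := LDPUpper.bound hγ hLDP1.2.2 hO.isClosed_compl hbd (by
    intro x hx
    by_contra hcon
    exact hx (hcov (not_le.1 hcon).le))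
  have hall : ∀ᶠ n in atTop, ∀ x ∈ t, μ n (Γ ∩ U x ×ˢ Set.univ) ≤ xp (γ n) b :=
    (Filter.eventually_all_finset t).2 fun x hx => (hU x (ht x hx)).2.2
  have hbig : ∀ᶠ n in atTop, Real.log (t.card + 1) ≤ γ n * (b - c) :=
    (hγ.atTop_mul_const (sub_pos.2 hcb)).eventually_ge_atTop _
  filter_upwards [hcompl, hall, hbig] with n h1 h2 h3
  have hsub : Γ ⊆ (⋃ x ∈ t, Γ ∩ U x ×ˢ Set.univ) ∪ Prod.fst ⁻¹' (⋃ x ∈ t, U x)ᶜ := by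
    rintro ⟨y1, y2⟩ hy
    by_cases hy1 : y1 ∈ ⋃ x ∈ t, U x
    · left
      simp only [Set.mem_iUnion] at hy1 ⊢
      obtain ⟨x, hx, hyx⟩ := hy1
      exact ⟨x, hx, hy, hyx, trivial⟩
    · right; exact hy1
  have hfst : μ n (Prod.fst ⁻¹' (⋃ x ∈ t, U x)ᶜ) ≤ xp (γ n) b := by
    rw [← Measure.fst_apply hO.measurableSet.compl]; exact h1
  calc μ n Γ ≤ μ n (⋃ x ∈ t, Γ ∩ U x ×ˢ Set.univ) + μ n (Prod.fst ⁻¹' (⋃ x ∈ t, U x)ᶜ) :=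
        (measure_mono hsub).trans (measure_union_le _ _)
    _ ≤ (∑ x ∈ t, μ n (Γ ∩ U x ×ˢ Set.univ)) + xp (γ n) b :=
        add_le_add (measure_biUnion_finset_le _ _) hfst
    _ ≤ (∑ x ∈ t, xp (γ n) b) + xp (γ n) b := by
        gcongr with x hx
        exact h2 x hx
    _ = ENNReal.ofReal (t.card + 1) * xp (γ n) b := by
        rw [Finset.sum_const, nsmul_eq_mul, ENNReal.ofReal_add (by positivity) zero_le_one, add_mul]
        simp
    _ ≤ xp (γ n) (c - b) * xp (γ n) b := by
        gcongr
        unfold xp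
        apply ENNReal.ofReal_le_ofReal
        rw [← Real.log_le_iff_le_exp (by positivity)]
        linarith
    _ = xp (γ n) c := by rw [xp_mul]; congr 1; ring

lemma marginal_lsc (I1 : E1 → ℝ≥0∞) (hI1good : GoodRate I1) (I : E1 × E2 → ℝ≥0∞)
    (hI : LowerSemicontinuous I) (hle : ∀ p, I1 p.1 ≤ I p) :
    LowerSemicontinuous fun x2 : E2 => ⨅ x1 : E1, I (x1, x2) := by
  intro x2 c hc
  obtain ⟨b, hcb, hb⟩ := exists_between hc
  have hbt : b ≠ ⊤ := (lt_of_lt_of_le hb le_top).ne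
  have hK : IsCompact {x | I1 x ≤ b} := by
    have := hI1good.2 b.toNNReal
    rwa [ENNReal.coe_toNNReal hbt] at this
  obtain ⟨U, V, hU, hV, hKU, hxV, hUV⟩ := generalized_tube_lemma hK
    (isCompact_singleton (x := x2)) (hI.isOpen_preimage b) (by
      rintro ⟨y1, y2⟩ ⟨-, h2⟩
      simp only [Set.mem_singleton_iff] at h2
      subst h2
      exact hb.trans_le (iInf_le _ y1))
  filter_upwards [hV.mem_nhds (hxV rfl)] with y hy
  refine hcb.trans_le (le_iInf fun x1 => ?_)
  by_cases h : I1 x1 ≤ b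
  · exact (show b < I (x1, y) from hUV (Set.mk_mem_prod (hKU h) hy)).le
  · exact (not_le.1 h).le.trans (hle (x1, y))

end core

/-- Chaganty's theorem on large deviations for joint and marginal
distributions. -/
theorem statement3 {E1 E2 : Type*} [TopologicalSpace E1] [PolishSpace E1]
    [MeasurableSpace E1] [BorelSpace E1]
    [TopologicalSpace E2] [PolishSpace E2] [MeasurableSpace E2] [BorelSpace E2]
    (μ : ℕ → Measure (E1 × E2)) (hμ : ∀ n, IsProbabilityMeasure (μ n))
    (γ : ℕ → ℝ) (hγ : Tendsto γ atTop atTop)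
    (ν : ℕ → E1 → Measure E2) (hνprob : ∀ n x1, IsProbabilityMeasure (ν n x1))
    (hνmeas : ∀ n (B : Set E2), MeasurableSet B → Measurable fun x1 => ν n x1 B)
    (hdisint : ∀ n (B1 : Set E1) (B2 : Set E2), MeasurableSet B1 → MeasurableSet B2 →
      μ n (B1 ×ˢ B2) = ∫⁻ x1 in B1, ν n x1 B2 ∂(μ n).fst)
    (I1 : E1 → ℝ≥0∞) (hI1good : GoodRate I1) (hLDP1 : LDP (fun n => (μ n).fst) γ I1)
    (J : E2 → E1 → ℝ≥0∞)
    (hJgood : ∀ x1, GoodRate fun x2 => J x2 x1)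
    (hJcont : ∀ (x1 : E1) (xs : ℕ → E1), Tendsto xs atTop (nhds x1) →
      LDP (fun n => ν n (xs n)) γ fun x2 => J x2 x1)
    (hJlsc : LowerSemicontinuous fun p : E1 × E2 => J p.2 p.1) :
    WLDP μ γ (fun p : E1 × E2 => I1 p.1 + J p.2 p.1) ∧
      LDP (fun n => (μ n).snd) γ (fun x2 => ⨅ x1 : E1, I1 x1 + J x2 x1) ∧
      (GoodRate (fun p : E1 × E2 => I1 p.1 + J p.2 p.1) →
        LDP μ γ (fun p : E1 × E2 => I1 p.1 + J p.2 p.1) ∧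
          GoodRate fun x2 : E2 => ⨅ x1 : E1, I1 x1 + J x2 x1) := by
  have hIlsc : LowerSemicontinuous (fun p : E1 × E2 => I1 p.1 + J p.2 p.1) :=
    (LowerSemicontinuous.comp hI1good.1 continuous_fst).add hJlsc
  have hlow := joint_lower μ γ hγ ν hdisint I1 hLDP1 J hJcont
  have hup := joint_upper μ hμ γ hγ ν hdisint I1 hI1good hLDP1 J hJgood hJcont
  have h2lsc : LowerSemicontinuous fun x2 : E2 => ⨅ x1 : E1, I1 x1 + J x2 x1 :=
    marginal_lsc I1 hI1good (fun p : E1 × E2 => I1 p.1 + J p.2 p.1) hIlsc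
      fun p => le_self_add
  have hsndprob : ∀ n, IsProbabilityMeasure ((μ n).snd) := fun n => inferInstance
  refine ⟨⟨hIlsc, hlow, fun Γ hΓ => hup Γ hΓ.isClosed⟩, ⟨h2lsc, ?_, ?_⟩, ?_⟩
  · refine LDPLower.of_bound hγ ?_
    intro Θ hΘ x2 hx2 c hc
    obtain ⟨x1, hx1⟩ := iInf_lt_iff.1 hc
    have := LDPLower.bound hγ hlow (hΘ.preimage continuous_snd) (x := (x1, x2)) hx2 hx1
    filter_upwards [this] with n hn
    rwa [Measure.snd_apply hΘ.measurableSet]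
  · refine LDPUpper.of_bound hγ hsndprob ?_
    intro Γ hΓ c d _ hcd hd
    have := LDPUpper.bound hγ hup (hΓ.preimage continuous_snd) hcd
      (fun p hp => (hd p.2 hp).trans (iInf_le _ p.1))
    filter_upwards [this] with n hn
    rwa [Measure.snd_apply hΓ.measurableSet]
  · intro hgood
    refine ⟨⟨hIlsc, hlow, hup⟩, h2lsc, fun a => ?_⟩
    refine ((hgood.2 (a + 1)).image continuous_snd).of_isClosed_subset
      (h2lsc.isClosed_preimage _) ?_
    intro x2 hx2
    have hlt : (⨅ x1 : E1, I1 x1 + J x2 x1) < ((a + 1 : ℝ≥0) : ℝ≥0∞) :=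
      lt_of_le_of_lt hx2 (ENNReal.coe_lt_coe.2 (lt_add_one a))
    obtain ⟨x1, hx1⟩ := iInf_lt_iff.1 hlt
    exact ⟨(x1, x2), hx1.le, rfl⟩

end
end

section
/- Let k be a continuous, symmetric, positive semidefinite kernel on [0,1]². For any λ₀ ∈ M[0,1], let x ∈ C be defined by x(t) = ∫₀¹ k(t,s) dλ₀(s). Then the Cramér transform satisfies Λ*_k(x) = (1/2)∫₀¹∫₀¹ k(t,s) dλ₀(t)dλ₀(s). -/
open MeasureTheory ProbabilityTheory Filter Topology
open scoped ENNReal NNReal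

noncomputable section

/-- Composite of a function with a simple function: integral as a finite sum. -/
lemma integral_comp_simple (μ : Measure UI) [IsFiniteMeasure μ] (T : SimpleFunc UI UI)
    (f : UI → ℝ) : ∫ t, f (T t) ∂μ = ∑ x ∈ T.range, μ.real (T ⁻¹' {x}) * f x := by
  classical
  have h : ∀ t, f (T t) = ∑ x ∈ T.range, (T ⁻¹' {x}).indicator (fun _ => f x) t := by
    intro t
    rw [Finset.sum_eq_single (T t)]
    · simp
    · intro b _ hb
      simp [Set.indicator, Ne.symm hb]
    · intro h
      exact absurd (T.mem_range_self t) h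
  simp_rw [h]
  rw [integral_finset_sum]
  · refine Finset.sum_congr rfl fun x _ => ?_
    rw [integral_indicator_const _ (T.measurableSet_fiber x), smul_eq_mul]
  · intro x _
    exact (integrable_const _).indicator (T.measurableSet_fiber x)

/-- Positivity for sums over finsets. -/
lemma psd_finset {k : UI → UI → ℝ} (hk : IsPSDKernel k) (s : Finset UI) (w : UI → ℝ) :
    0 ≤ ∑ x ∈ s, ∑ y ∈ s, w x * w y * k x y := by
  have h := hk.2.2 s.card (fun i => (s.equivFin.symm i : UI)) (fun i => w (s.equivFin.symm i))
  have e : ∀ g : UI → ℝ, ∑ i, g (s.equivFin.symm i) = ∑ x ∈ s, g x := by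
    intro g
    rw [Equiv.sum_comp s.equivFin.symm (fun x : s => g x), Finset.sum_coe_sort s g]
  rw [← e (fun x => ∑ y ∈ s, w x * w y * k x y)]
  simp_rw [← e (fun y => _ * w y * k _ y)]
  exact h

/-- The double integral for a pair of measures. -/
def dI (k : UI → UI → ℝ) (μ ν : Measure UI) : ℝ := ∫ t, ∫ s, k t s ∂ν ∂μ

lemma kbound {k : UI → UI → ℝ} (hk : IsPSDKernel k) : ∃ C, ∀ t s, ‖k t s‖ ≤ C := by
  obtain ⟨C, hC⟩ := isCompact_univ.exists_bound_of_continuousOn hk.1.continuousOn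
  exact ⟨C, fun t s => hC (t, s) trivial⟩

/-- Approximating simple functions. -/
def TT (n : ℕ) : SimpleFunc UI UI :=
  SimpleFunc.approxOn (id : UI → UI) measurable_id Set.univ 0 trivial n

lemma TT_tendsto (t : UI) : Tendsto (fun n => TT n t) atTop (𝓝 t) := by
  have := SimpleFunc.tendsto_approxOn (f := (id : UI → UI)) measurable_id (s := Set.univ)
    (y₀ := 0) trivial (x := t) (by simp)
  exact this

lemma dI_tendsto {k : UI → UI → ℝ} (hk : IsPSDKernel k) (μ ν : Measure UI)
    [IsFiniteMeasure μ] [IsFiniteMeasure ν] :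
    Tendsto (fun n => ∫ t, ∫ s, k (TT n t) (TT n s) ∂ν ∂μ) atTop (𝓝 (dI k μ ν)) := by
  obtain ⟨C, hC⟩ := kbound hk
  refine tendsto_integral_of_dominated_convergence (fun _ => C * ν.real Set.univ) ?_
    (integrable_const _) ?_ ?_
  · intro n
    exact ((TT n).map (fun x => ∫ s, k x (TT n s) ∂ν)).aestronglyMeasurable
  · intro n
    refine Eventually.of_forall fun t => ?_
    exact norm_integral_le_of_norm_le_const (Eventually.of_forall fun s => hC _ _)
  · refine Eventually.of_forall fun t => ?_
    refine tendsto_integral_of_dominated_convergence (fun _ => C) ?_ (integrable_const _) ?_ ?_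
    · intro n
      exact ((TT n).map (fun x => k (TT n t) x)).aestronglyMeasurable
    · intro n
      exact Eventually.of_forall fun s => hC _ _
    · refine Eventually.of_forall fun s => ?_
      exact (hk.1.tendsto (t, s)).comp ((TT_tendsto t).prodMk_nhds (TT_tendsto s))

lemma dI_psd {k : UI → UI → ℝ} (hk : IsPSDKernel k) (P N : Measure UI)
    [IsFiniteMeasure P] [IsFiniteMeasure N] :
    0 ≤ dI k P P - dI k P N - dI k N P + dI k N N := by
  refine ge_of_tendsto' ((((dI_tendsto hk P P).sub (dI_tendsto hk P N)).sub
    (dI_tendsto hk N P)).add (dI_tendsto hk N N)) fun n => ?_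
  have e : ∀ (μ ν : Measure UI) [IsFiniteMeasure μ] [IsFiniteMeasure ν],
      ∫ t, ∫ s, k (TT n t) (TT n s) ∂ν ∂μ = ∑ x ∈ (TT n).range, ∑ y ∈ (TT n).range,
        μ.real (TT n ⁻¹' {x}) * ν.real (TT n ⁻¹' {y}) * k x y := by
    intro μ ν _ _
    rw [integral_comp_simple μ (TT n) (fun x => ∫ s, k x (TT n s) ∂ν)]
    refine Finset.sum_congr rfl fun x _ => ?_
    rw [integral_comp_simple ν (TT n) (fun y => k x y), Finset.mul_sum]
    exact Finset.sum_congr rfl fun y _ => by ring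
  rw [e P P, e P N, e N P, e N N]
  have h := psd_finset hk (TT n).range
    (fun x => P.real (TT n ⁻¹' {x}) - N.real (TT n ⁻¹' {x}))
  refine h.trans_eq ?_
  simp only [← Finset.sum_sub_distrib, ← Finset.sum_add_distrib]
  exact Finset.sum_congr rfl fun x _ => Finset.sum_congr rfl fun y _ => by ring

lemma dI_symm {k : UI → UI → ℝ} (hk : IsPSDKernel k) (μ ν : Measure UI)
    [IsFiniteMeasure μ] [IsFiniteMeasure ν] : dI k μ ν = dI k ν μ := by
  obtain ⟨C, hC⟩ := kbound hk
  unfold dI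
  rw [integral_integral_swap]
  · simp_rw [hk.2.1]
  · exact (integrable_const C).mono' hk.1.aestronglyMeasurable
      (Eventually.of_forall fun p => hC p.1 p.2)

lemma int_inner {k : UI → UI → ℝ} (hk : IsPSDKernel k) (t : UI) (ν : Measure UI)
    [IsFiniteMeasure ν] : Integrable (fun s => k t s) ν := by
  obtain ⟨C, hC⟩ := kbound hk
  have hc : Continuous (fun s => k t s) := hk.1.comp (Continuous.prodMk_right t)
  exact (integrable_const C).mono' hc.aestronglyMeasurable
      (Eventually.of_forall fun s => hC t s)

lemma int_outer {k : UI → UI → ℝ} (hk : IsPSDKernel k) (μ ν : Measure UI)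
    [IsFiniteMeasure μ] [IsFiniteMeasure ν] : Integrable (fun t => ∫ s, k t s ∂ν) μ := by
  obtain ⟨C, hC⟩ := kbound hk
  have h : Integrable (fun p : UI × UI => k p.1 p.2) (μ.prod ν) :=
    (integrable_const C).mono' hk.1.aestronglyMeasurable
      (Eventually.of_forall fun p => hC p.1 p.2)
  exact h.integral_prod_left

lemma dI_add_right {k : UI → UI → ℝ} (hk : IsPSDKernel k) (μ ν ρ : Measure UI)
    [IsFiniteMeasure μ] [IsFiniteMeasure ν] [IsFiniteMeasure ρ] :
    dI k μ (ν + ρ) = dI k μ ν + dI k μ ρ := by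
  unfold dI
  rw [← integral_add (int_outer hk μ ν) (int_outer hk μ ρ)]
  congr 1
  ext t
  exact integral_add_measure (int_inner hk t ν) (int_inner hk t ρ)

lemma dI_add_left {k : UI → UI → ℝ} (hk : IsPSDKernel k) (μ ν ρ : Measure UI)
    [IsFiniteMeasure μ] [IsFiniteMeasure ν] [IsFiniteMeasure ρ] :
    dI k (ν + ρ) μ = dI k ν μ + dI k ρ μ := by
  unfold dI
  exact integral_add_measure (int_outer hk ν μ) (int_outer hk ρ μ)

lemma pair_eq {k : UI → UI → ℝ} (hk : IsPSDKernel k) (lam lam0 : SignedMeasure UI) :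
    pairSM lam (fun t => pairSM lam0 fun s => k t s) =
      dI k lam.toJordanDecomposition.posPart lam0.toJordanDecomposition.posPart
      - dI k lam.toJordanDecomposition.posPart lam0.toJordanDecomposition.negPart
      - (dI k lam.toJordanDecomposition.negPart lam0.toJordanDecomposition.posPart
      - dI k lam.toJordanDecomposition.negPart lam0.toJordanDecomposition.negPart) := by
  unfold pairSM dI
  rw [integral_sub (int_outer hk _ _) (int_outer hk _ _),
    integral_sub (int_outer hk _ _) (int_outer hk _ _)]

theorem statement4 (k : UI → UI → ℝ) (hk : IsPSDKernel k)
    (lam0 : MeasureTheory.SignedMeasure UI) :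
    CramerK k (fun t => pairSM lam0 fun s => k t s) =
      ENNReal.ofReal ((1/2) * dblInt lam0 k) := by
  unfold CramerK
  apply le_antisymm
  · refine iSup_le fun lam => ENNReal.ofReal_le_ofReal ?_
    unfold LamK dblInt
    rw [pair_eq hk, pair_eq hk, pair_eq hk]
    generalize lam.toJordanDecomposition = j
    generalize lam0.toJordanDecomposition = j0
    have h := dI_psd hk (j.posPart + j0.negPart) (j.negPart + j0.posPart)
    simp only [dI_add_left hk, dI_add_right hk] at h
    have h1 := dI_symm hk j.posPart j0.posPart
    have h2 := dI_symm hk j.posPart j0.negPart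
    have h3 := dI_symm hk j.negPart j0.posPart
    have h4 := dI_symm hk j.negPart j0.negPart
    linarith
  · refine le_trans (le_of_eq ?_)
      (le_iSup (fun lam => ENNReal.ofReal
        (pairSM lam (fun t => pairSM lam0 fun s => k t s) - LamK k lam)) lam0)
    congr 1
    unfold LamK dblInt
    ring

end
end

section
/- Let ((Xⁿ_t)_{t∈[0,1]}) be a family of continuous Gaussian processes (C-valued random variables) with Xⁿ_0 = 0 almost surely for all n, and let mⁿ(t) = E[Xⁿ_t] and kⁿ(t,s) = Cov(Xⁿ_t, Xⁿ_s). Suppose there exist constants α, M₁, M₂ > 0 such that for all n and all s ≠ t in [0,1]: |mⁿ(t) − mⁿ(s)| ≤ M₁|t−s|^α and γ(n)·|kⁿ(t,t) + kⁿ(s,s) − 2kⁿ(s,t)| ≤ M₂|t−s|^{2α}. Then the family (Xⁿ) is exponentially tight at speed γ(n). -/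
open MeasureTheory ProbabilityTheory Filter Topology
open scoped ENNReal NNReal

noncomputable section

/-- Dyadic points. -/
def dyp (j i : ℕ) : UI := Set.projIcc 0 1 zero_le_one ((i:ℝ)/2^j)

lemma dyp_double (j i : ℕ) : dyp (j+1) (2*i) = dyp j i := by
  unfold dyp
  congr 1
  push_cast
  rw [pow_succ]
  field_simp

lemma dyp_tendsto (t : UI) : Tendsto (fun j => dyp j ⌊(2:ℝ)^j * t⌋₊) atTop (𝓝 t) := by
  have h1 : Tendsto (fun j : ℕ => ((⌊(t:ℝ) * (2:ℝ)^j⌋₊ : ℝ)/ (2:ℝ)^j)) atTop (𝓝 (t:ℝ)) :=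
    (tendsto_nat_floor_mul_div_atTop (R := ℝ) t.2.1).comp
      (tendsto_pow_atTop_atTop_of_one_lt one_lt_two)
  have h2 : Continuous (Set.projIcc (0:ℝ) 1 zero_le_one) := continuous_projIcc
  have h3 := (h2.tendsto (t:ℝ)).comp h1
  rw [Set.projIcc_val] at h3
  refine h3.congr fun j => ?_
  simp [dyp, mul_comm]

lemma chain_step (f : UI → ℝ) (b : ℕ → ℝ)
    (hf : ∀ j i, |f (dyp j (i+1)) - f (dyp j i)| ≤ b j) (t : UI) (j : ℕ) :
    |f (dyp j ⌊(2:ℝ)^j * t⌋₊) - f (dyp (j+1) ⌊(2:ℝ)^(j+1) * t⌋₊)| ≤ b (j+1) := by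
  have ht := t.2.1
  have h0 : 0 ≤ (2:ℝ)^j * t := by positivity
  have h0' : 0 ≤ (2:ℝ)^(j+1) * t := by positivity
  have hb : 0 ≤ b (j+1) := (abs_nonneg _).trans (hf (j+1) 0)
  set n := ⌊(2:ℝ)^j * t⌋₊ with hn
  have h1 : (n:ℝ) ≤ (2:ℝ)^j * t := Nat.floor_le h0
  have h2 : (2:ℝ)^j * t < n + 1 := Nat.lt_floor_add_one _
  have h3 : (2:ℝ)^(j+1) * t = 2 * ((2:ℝ)^j * t) := by ring
  have h4 : 2 * n ≤ ⌊(2:ℝ)^(j+1) * t⌋₊ := Nat.le_floor (by push_cast; linarith)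
  have h5 : ⌊(2:ℝ)^(j+1) * t⌋₊ < 2 * n + 2 := (Nat.floor_lt h0').2 (by push_cast; linarith)
  rcases (by omega : ⌊(2:ℝ)^(j+1) * t⌋₊ = 2 * n ∨ ⌊(2:ℝ)^(j+1) * t⌋₊ = 2 * n + 1) with h | h
  · rw [h, dyp_double]; simpa using hb
  · rw [h, ← dyp_double, abs_sub_comm]; exact hf _ _

lemma chain_tail (f : UI → ℝ) (hc : Continuous f) (b : ℕ → ℝ) (hb : Summable b)
    (hf : ∀ j i, |f (dyp j (i+1)) - f (dyp j i)| ≤ b j) (t : UI) (J : ℕ) :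
    |f (dyp J ⌊(2:ℝ)^J * t⌋₊) - f t| ≤ ∑' n, b (n + (J+1)) := by
  have h1 : Tendsto (fun n => f (dyp (n+J) ⌊(2:ℝ)^(n+J) * t⌋₊)) atTop (𝓝 (f t)) :=
    (hc.tendsto t).comp ((dyp_tendsto t).comp (tendsto_add_atTop_nat J))
  have h2 := dist_le_tsum_of_dist_le_of_tendsto₀ (fun n => b (n + (J+1)))
    (fun n => ?_) ((summable_nat_add_iff (J+1)).2 hb) h1
  · simpa [Real.dist_eq] using h2
  · have := chain_step f b hf t (n+J)
    rw [Real.dist_eq, show n.succ + J = n + J + 1 by omega]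
    exact this

lemma chain_mod (f : UI → ℝ) (hc : Continuous f) (b : ℕ → ℝ) (hb : Summable b)
    (hf : ∀ j i, |f (dyp j (i+1)) - f (dyp j i)| ≤ b j) (J : ℕ) (s t : UI)
    (hst : |(t:ℝ) - s| ≤ 1 / 2^J) :
    |f t - f s| ≤ b J + 2 * ∑' n, b (n + (J+1)) := by
  wlog h : (s:ℝ) ≤ t generalizing s t
  · rw [abs_sub_comm]
    exact this t s (by rwa [abs_sub_comm]) (le_of_not_ge h)
  have hs := s.2.1
  have hb0 : 0 ≤ b J := (abs_nonneg _).trans (hf J 0)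
  have h1 := chain_tail f hc b hb hf s J
  have h2 := chain_tail f hc b hb hf t J
  have hp : (0:ℝ) < 2^J := by positivity
  rw [abs_of_nonneg (by linarith), le_div_iff₀ hp] at hst
  have h3 : ⌊(2:ℝ)^J * s⌋₊ ≤ ⌊(2:ℝ)^J * t⌋₊ := Nat.floor_mono (by gcongr)
  have h4 : ⌊(2:ℝ)^J * t⌋₊ ≤ ⌊(2:ℝ)^J * s⌋₊ + 1 := by
    rw [← Nat.floor_add_one (by positivity)]
    exact Nat.floor_mono (by nlinarith)
  have h5 : |f (dyp J ⌊(2:ℝ)^J * t⌋₊) - f (dyp J ⌊(2:ℝ)^J * s⌋₊)| ≤ b J := by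
    rcases (by omega : ⌊(2:ℝ)^J * t⌋₊ = ⌊(2:ℝ)^J * s⌋₊ ∨ ⌊(2:ℝ)^J * t⌋₊ = ⌊(2:ℝ)^J * s⌋₊ + 1)
      with h | h
    · rw [h]; simpa using hb0
    · rw [h]; exact hf _ _
  rw [abs_le] at *
  constructor <;> linarith

/-- The compact set. -/
def KK (b : ℕ → ℝ) : Set CC :=
  {f | f ⟨0, Set.left_mem_Icc.mpr zero_le_one⟩ = 0 ∧
    ∀ j i, |f (dyp j (i+1)) - f (dyp j i)| ≤ b j}

lemma KK_compact (b : ℕ → ℝ) (hb : Summable b) : IsCompact (KK b) := by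
  let A : Set (BoundedContinuousFunction UI ℝ) :=
    {f | f ⟨0, Set.left_mem_Icc.mpr zero_le_one⟩ = 0 ∧
    ∀ j i, |f (dyp j (i+1)) - f (dyp j i)| ≤ b j}
  have hA : IsCompact A := by
    refine BoundedContinuousFunction.arzela_ascoli₂
      (Set.Icc (-(b 0 + 2 * ∑' n, b (n + (0+1)))) (b 0 + 2 * ∑' n, b (n + (0+1))))
      isCompact_Icc A ?_ ?_ ?_
    · have hev : ∀ x : UI, Continuous fun f : BoundedContinuousFunction UI ℝ => f x :=
        fun x => by fun_prop
      refine (isClosed_eq (hev _) continuous_const).inter ?_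
      have : {f : BoundedContinuousFunction UI ℝ |
          ∀ j i, |f (dyp j (i+1)) - f (dyp j i)| ≤ b j} =
          ⋂ j, ⋂ i, {f | |f (dyp j (i+1)) - f (dyp j i)| ≤ b j} := by ext; simp
      change IsClosed {f : BoundedContinuousFunction UI ℝ |
          ∀ j i, |f (dyp j (i+1)) - f (dyp j i)| ≤ b j}
      rw [this]
      exact isClosed_iInter fun j => isClosed_iInter fun i =>
        isClosed_le ((hev _).sub (hev _)).abs continuous_const
    · intro f x hf
      have := chain_mod f f.continuous b hb hf.2 0 ⟨0, Set.left_mem_Icc.mpr zero_le_one⟩ x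
        (by rw [abs_le]; have := x.2.1; have := x.2.2; constructor <;> simp <;> linarith)
      rw [hf.1, sub_zero] at this
      exact abs_le.1 this
    · intro x
      rw [Metric.equicontinuousAt_iff]
      intro ε hε
      have h1 : Tendsto (fun J => b J + 2 * ∑' n, b (n + (J+1))) atTop (𝓝 0) := by
        have := hb.tendsto_atTop_zero.add
          (((tendsto_sum_nat_add b).comp (tendsto_add_atTop_nat 1)).const_mul 2)
        simpa using this
      obtain ⟨J, hJ⟩ := (h1.eventually_lt_const hε).exists
      refine ⟨1/2^J, by positivity, fun y hy f => ?_⟩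
      rw [Real.dist_eq]
      refine lt_of_le_of_lt (chain_mod f.1 f.1.continuous b hb f.2.2 J y x ?_) hJ
      rw [Subtype.dist_eq, Real.dist_eq, abs_sub_comm] at hy
      exact hy.le
  have := (ContinuousMap.isometryEquivBoundedOfCompact UI ℝ).toHomeomorph.isCompact_preimage.2 hA
  exact this

lemma pair_dirac_sub (s t : UI) (hst : s ≠ t) :
    ∃ lam : SignedMeasure UI, ∀ h : UI → ℝ, pairSM lam h = h t - h s := by
  let j : JordanDecomposition UI :=
    { posPart := Measure.dirac t
      negPart := Measure.dirac s
      mutuallySingular := ⟨{s}, measurableSet_singleton _, by simp [hst.symm], by simp⟩ }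
  refine ⟨j.toSignedMeasure, fun h => ?_⟩
  rw [pairSM, JordanDecomposition.toJordanDecomposition_toSignedMeasure]
  simp [j]

lemma pair_dirac (t : UI) :
    ∃ lam : SignedMeasure UI, ∀ h : UI → ℝ, pairSM lam h = h t := by
  let j : JordanDecomposition UI :=
    { posPart := Measure.dirac t
      negPart := 0
      mutuallySingular := Measure.MutuallySingular.zero_right }
  refine ⟨j.toSignedMeasure, fun h => ?_⟩
  rw [pairSM, JordanDecomposition.toJordanDecomposition_toSignedMeasure]
  simp [j]

lemma gauss_facts {Ω : Type*} [MeasurableSpace Ω] (P : Measure Ω) [IsProbabilityMeasure P]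
    (ξ : Ω → ℝ) (hξ : Measurable ξ) (μ : ℝ) (v : ℝ≥0) (h : P.map ξ = gaussianReal μ v) :
    MemLp ξ 2 P ∧ ∫ ω, ξ ω ∂P = μ ∧ ∫ ω, (ξ ω - μ)^2 ∂P = v := by
  have hm : ∫ ω, ξ ω ∂P = μ := by
    have := integral_map (μ := P) hξ.aemeasurable (f := fun x : ℝ => x) (by fun_prop)
    rw [← this, h, integral_id_gaussianReal]
  refine ⟨?_, hm, ?_⟩
  · have := memLp_id_gaussianReal' (μ := μ) (v := v) 2 (by simp)
    rw [← h, memLp_map_measure_iff (by fun_prop) hξ.aemeasurable] at this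
    exact this
  · have h1 := variance_id_gaussianReal (μ := μ) (v := v)
    rw [← h, variance_id_map hξ.aemeasurable, variance_eq_integral hξ.aemeasurable, hm] at h1
    exact h1

lemma gauss_tail {Ω : Type*} [MeasurableSpace Ω] (P : Measure Ω) [IsProbabilityMeasure P]
    (ξ : Ω → ℝ) (hξ : Measurable ξ) (μ : ℝ) (v : ℝ≥0) (h : P.map ξ = gaussianReal μ v)
    (c : ℝ≥0) (hv : v ≤ c) (ε : ℝ) (hε : 0 ≤ ε) (b : ℝ) (hb : ε + |μ| ≤ b) :
    P {ω | b < |ξ ω|} ≤ ENNReal.ofReal (2 * Real.exp (-ε^2 / (2 * c))) := by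
  have key : ∀ (η : Ω → ℝ) (hη : Measurable η) (w : ℝ), P.map η = gaussianReal w v →
      P {ω | ε ≤ η ω - w} ≤ ENNReal.ofReal (Real.exp (-ε^2 / (2 * c))) := by
    intro η hη w hw
    have h2 : P.map (fun ω => η ω - w) = gaussianReal 0 v := by
      have := gaussianReal_sub_const (X := η) (P := P) ⟨hη.aemeasurable, hw⟩ w
      simpa using this.map_eq
    have hs : HasSubgaussianMGF (fun ω => η ω - w) c P := by
      constructor
      · intro t
        have := integrable_exp_mul_gaussianReal (μ := 0) (v := v) t
        rw [← h2, integrable_map_measure (by fun_prop) (by fun_prop)] at this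
        exact this
      · intro t
        rw [mgf_gaussianReal h2]
        have : (v:ℝ) ≤ c := hv
        gcongr
        simp
        gcongr
    have := hs.measure_ge_le hε
    rw [Measure.real] at this
    exact (ENNReal.le_ofReal_iff_toReal_le (measure_ne_top _ _) (by positivity)).2 this
  have k1 := key ξ hξ μ h
  have k2 := key (fun ω => - ξ ω) hξ.neg (-μ) (by
    have := gaussianReal_neg (X := ξ) (P := P) ⟨hξ.aemeasurable, h⟩
    exact this.map_eq)
  have hsub : {ω | b < |ξ ω|} ⊆ {ω | ε ≤ ξ ω - μ} ∪ {ω | ε ≤ - ξ ω - -μ} := by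
    intro ω hω
    simp only [Set.mem_ofPred_eq, Set.mem_union] at *
    have := le_abs_self μ
    have := neg_abs_le μ
    rcases lt_abs.1 hω with h | h
    · left; linarith
    · right; linarith
  refine (measure_mono hsub).trans ((measure_union_le _ _).trans ?_)
  rw [two_mul, ENNReal.ofReal_add (by positivity) (by positivity)]
  exact add_le_add k1 k2

lemma incr_tail {Ω : Type*} [MeasurableSpace Ω] (P : Measure Ω) [IsProbabilityMeasure P]
    (X : Ω → CC) (hX : IsContGaussian P X) (g : ℝ) (hg : 0 < g)
    (m : UI → ℝ) (hm : ∀ t, m t = ∫ ω, X ω t ∂P)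
    (k : UI → UI → ℝ)
    (hk : ∀ t s, k t s = ∫ ω, (X ω t - m t) * (X ω s - m s) ∂P)
    (s t : UI) (hst : s ≠ t) (A B : ℝ) (hB : 0 ≤ B)
    (hmean : |m t - m s| ≤ A) (hcov : g * |k t t + k s s - 2 * k s t| ≤ B)
    (ε : ℝ) (hε : 0 ≤ ε) :
    P {ω | ε + A < |X ω t - X ω s|} ≤ ENNReal.ofReal (2 * Real.exp (-ε^2 * g / (2 * B))) := by
  obtain ⟨hXm, hXg⟩ := hX
  have hev : ∀ t, Measurable fun ω => X ω t := fun t =>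
    (by fun_prop : Continuous fun f : CC => f t).measurable.comp hXm
  have hL2 : ∀ t, MemLp (fun ω => X ω t) 2 P := by
    intro t
    obtain ⟨lam, hl⟩ := pair_dirac t
    obtain ⟨μ, v, h⟩ := hXg lam
    simp only [hl] at h
    exact (gauss_facts P _ (hev t) μ v h).1
  obtain ⟨lam, hl⟩ := pair_dirac_sub s t hst
  obtain ⟨μ, v, h⟩ := hXg lam
  simp only [hl] at h
  obtain ⟨-, h1, h2⟩ := gauss_facts P _ ((hev t).sub (hev s)) μ v h
  have hμ : μ = m t - m s := by
    rw [← h1, hm, hm]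
    exact integral_sub ((hL2 t).integrable (by norm_num)) ((hL2 s).integrable (by norm_num))
  have hc : ∀ t, MemLp (fun ω => X ω t - m t) 2 P := fun t => (hL2 t).sub (memLp_const _)
  have hi : ∀ t s, Integrable (fun ω => (X ω t - m t) * (X ω s - m s)) P := fun t s =>
    (hc t).integrable_mul (hc s)
  have hv : (v:ℝ) = k t t + k s s - 2 * k s t := by
    rw [← h2, hk, hk, hk, ← integral_const_mul, ← integral_add (hi t t) (hi s s)]
    refine Eq.trans ?_ (integral_sub ((hi t t).add (hi s s)) ((hi s t).const_mul 2))
    congr 1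
    ext ω
    simp only [hμ, Pi.add_apply, Pi.sub_apply]
    ring
  have hvB : v ≤ (B / g).toNNReal := by
    rw [← NNReal.coe_le_coe, hv, Real.coe_toNNReal _ (by positivity)]
    rw [le_div_iff₀ hg, mul_comm]
    exact (mul_le_mul_of_nonneg_left (le_abs_self _) hg.le).trans hcov
  have := gauss_tail P _ ((hev t).sub (hev s)) μ v h _ hvB ε hε (ε + A) (by rw [hμ]; linarith)
  refine this.trans (le_of_eq ?_)
  congr 3
  rw [Real.coe_toNNReal _ (by positivity), mul_div_assoc', div_div_eq_mul_div]

lemma elog_bound (g : ℝ) (hg : 0 < g) (R : ℝ) (p : ℝ≥0∞)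
    (hp : p ≤ ENNReal.ofReal (Real.exp (-(g * R)))) :
    ((g⁻¹ : ℝ) : EReal) * elog p ≤ ((-R : ℝ) : EReal) := by
  have hg' : 0 < g⁻¹ := inv_pos.2 hg
  unfold elog
  have htop : p ≠ ⊤ := ne_top_of_le_ne_top ENNReal.ofReal_ne_top hp
  split_ifs with h0
  · rw [EReal.coe_mul_bot_of_pos hg']; exact bot_le
  · rw [← EReal.coe_mul, EReal.coe_le_coe_iff]
    have h1 : p.toReal ≤ Real.exp (-(g * R)) :=
      ENNReal.toReal_le_of_le_ofReal (Real.exp_pos _).le hp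
    have h2 : Real.log p.toReal ≤ -(g * R) :=
      (Real.log_le_iff_le_exp (ENNReal.toReal_pos h0 htop)).2 h1
    calc g⁻¹ * Real.log p.toReal ≤ g⁻¹ * (-(g*R)) := by gcongr
      _ = -R := by field_simp

lemma dyp_eq_of_le (j i : ℕ) (h : 2^j ≤ i) : dyp j i = ⟨1, Set.right_mem_Icc.mpr zero_le_one⟩ := by
  unfold dyp
  apply Set.projIcc_of_right_le
  rw [le_div_iff₀ (by positivity), one_mul]
  exact_mod_cast h

lemma dyp_val (j i : ℕ) (h : i ≤ 2^j) : (dyp j i : ℝ) = (i:ℝ) / 2^j := by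
  unfold dyp
  rw [Set.projIcc_of_mem zero_le_one (x := (i:ℝ)/2^j)]
  refine ⟨by positivity, ?_⟩
  rw [div_le_one (by positivity)]
  exact_mod_cast h

lemma dyp_diff (j i : ℕ) (h : i < 2^j) : |(dyp j (i+1) : ℝ) - dyp j i| = (1/2)^j := by
  rw [dyp_val j _ h, dyp_val j _ h.le, ← sub_div]
  push_cast
  rw [add_sub_cancel_left, abs_of_pos (by positivity)]
  simp

lemma geom_bound (q : ℝ) (hq : 0 ≤ q) (hq2 : q ≤ 1/2) :
    ∑' j : ℕ, ENNReal.ofReal (q^(j+1)) ≤ ENNReal.ofReal (2 * q) := by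
  have hs : Summable fun j : ℕ => q^j := summable_geometric_of_lt_one hq (by linarith)
  have hs' : Summable fun j : ℕ => q^(j+1) := (summable_nat_add_iff 1).2 hs
  rw [← ENNReal.ofReal_tsum_of_nonneg (fun j => by positivity) hs']
  apply ENNReal.ofReal_le_ofReal
  simp only [pow_succ]
  rw [tsum_mul_right, tsum_geometric_of_lt_one hq (by linarith)]
  gcongr
  rw [inv_le_comm₀ (by linarith) (by norm_num)]
  linarith

lemma KK_prob {Ω : Type*} [MeasurableSpace Ω] (P : Measure Ω) [IsProbabilityMeasure P]
    (X : Ω → CC) (hX : IsContGaussian P X)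
    (hX0 : ∀ᵐ ω ∂P, X ω ⟨0, Set.left_mem_Icc.mpr zero_le_one⟩ = 0)
    (g : ℝ) (hg : 0 < g)
    (m : UI → ℝ) (hm : ∀ t, m t = ∫ ω, X ω t ∂P)
    (k : UI → UI → ℝ)
    (hk : ∀ t s, k t s = ∫ ω, (X ω t - m t) * (X ω s - m s) ∂P)
    (α M1 M2 : ℝ) (hM1 : 0 < M1) (hM2 : 0 < M2)
    (hmean : ∀ (s t : UI), s ≠ t →
      |m t - m s| ≤ M1 * |(t : ℝ) - (s : ℝ)| ^ α)
    (hcov : ∀ (s t : UI), s ≠ t →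
      g * |k t t + k s s - 2 * k s t| ≤ M2 * |(t : ℝ) - (s : ℝ)| ^ (2 * α))
    (c : ℝ) (hc : 0 ≤ c) (hgc : 2 * Real.exp (-(g * c)) ≤ 1/2) :
    P (X ⁻¹' (KK fun j => (Real.sqrt (2 * M2 * c) + M1) * ((j + 1 : ℝ) * ((1/2:ℝ)^α)^j))ᶜ) ≤
      ENNReal.ofReal (4 * Real.exp (-(g * c))) := by
  set r : ℝ := (1/2:ℝ)^α with hr
  have hr0 : 0 < r := by positivity
  set S := Real.sqrt (2 * M2 * c) with hS
  have hS0 : 0 ≤ S := Real.sqrt_nonneg _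
  have hS2 : S^2 = 2 * M2 * c := Real.sq_sqrt (by positivity)
  set b : ℕ → ℝ := fun j => (S + M1) * ((j + 1 : ℝ) * r^j) with hb
  let E : ℕ → ℕ → Set Ω := fun j i => {ω | b j < |X ω (dyp j (i+1)) - X ω (dyp j i)|}
  have hE : ∀ j, ∀ i < 2^j, P (E j i) ≤ ENNReal.ofReal (2 * Real.exp (-(g * c)) ^ (j+1)) := by
    intro j i hi
    have hd := dyp_diff j i hi
    have hne : dyp j i ≠ dyp j (i+1) := by
      intro h
      rw [h, sub_self, abs_zero] at hd
      have : (0:ℝ) < (1/2)^j := by positivity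
      linarith
    have e1 : ((1/2:ℝ)^j)^α = r^j := by
      rw [hr, ← Real.rpow_natCast, ← Real.rpow_natCast, ← Real.rpow_mul (by norm_num),
        ← Real.rpow_mul (by norm_num), mul_comm]
    have e2 : ((1/2:ℝ)^j)^(2*α) = (r^j)^2 := by
      rw [← e1, mul_comm 2 α, Real.rpow_mul (by positivity)]
      exact Real.rpow_natCast _ 2
    have h1 := hmean _ _ hne
    have h2 := hcov _ _ hne
    rw [hd, e1] at h1
    rw [hd, e2] at h2
    have hrj : 0 < r^j := by positivity
    have h3 := incr_tail P X hX g hg m hm k hk _ _ hne _ _ (by positivity) h1 h2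
      (S * ((j+1:ℝ) * r^j)) (by positivity)
    refine (measure_mono ?_).trans (h3.trans (ENNReal.ofReal_le_ofReal ?_))
    · intro ω hω
      simp only [E, Set.mem_ofPred_eq] at hω ⊢
      refine lt_of_le_of_lt ?_ hω
      simp only [hb]
      have : 0 ≤ (j:ℝ) * r^j := by positivity
      nlinarith
    · rw [← Real.exp_nat_mul]
      have : -(S * ((j+1:ℝ) * r^j))^2 * g / (2 * (M2 * (r^j)^2)) = -(g * c) * (j+1:ℝ)^2 := by
        rw [mul_pow, hS2]; field_simp
      rw [this]
      refine mul_le_mul_of_nonneg_left (Real.exp_le_exp.2 ?_) zero_le_two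
      push_cast
      have : 0 ≤ g * c := by positivity
      have : (0:ℝ) ≤ j := by positivity
      have : 0 ≤ (g * c) * ((j+1:ℝ) * j) := by positivity
      nlinarith
  have hsub : X ⁻¹' (KK b)ᶜ ⊆ {ω | ¬ X ω ⟨0, Set.left_mem_Icc.mpr zero_le_one⟩ = 0} ∪
      ⋃ j, ⋃ i ∈ Finset.range (2^j), E j i := by
    intro ω hω
    by_contra hcon
    simp only [Set.mem_union, Set.mem_iUnion, not_or, not_exists, Set.mem_ofPred_eq, not_not,
      E, Finset.mem_range, not_lt] at hcon
    apply hω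
    refine ⟨hcon.1, fun j i => ?_⟩
    by_cases hi : i < 2^j
    · exact hcon.2 j i hi
    · rw [dyp_eq_of_le j i (by omega), dyp_eq_of_le j (i+1) (by omega), sub_self, abs_zero]
      simp only [hb]
      positivity
  calc P (X ⁻¹' (KK b)ᶜ) ≤ _ := measure_mono hsub
    _ ≤ _ := measure_union_le _ _
    _ = P (⋃ j, ⋃ i ∈ Finset.range (2^j), E j i) := by
      rw [ae_iff.1 hX0, zero_add]
    _ ≤ ∑' j, P (⋃ i ∈ Finset.range (2^j), E j i) := measure_iUnion_le _
    _ ≤ ∑' j : ℕ, ENNReal.ofReal ((2 * Real.exp (-(g * c)))^(j+1)) := by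
      refine ENNReal.tsum_le_tsum fun j => ?_
      refine (measure_biUnion_finset_le _ _).trans ?_
      refine (Finset.sum_le_sum fun i hi => hE j i (Finset.mem_range.1 hi)).trans ?_
      rw [Finset.sum_const, Finset.card_range, nsmul_eq_mul, ← ENNReal.ofReal_natCast,
        ← ENNReal.ofReal_mul (by positivity)]
      apply ENNReal.ofReal_le_ofReal
      rw [mul_pow]
      push_cast
      rw [pow_succ 2 j]
      linarith
    _ ≤ _ := geom_bound _ (by positivity) hgc
    _ = _ := by congr 1; ring

/-- Hölder-type bounds on means and covariances imply exponential
tightness. -/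
theorem statement6 {Ω : Type*} [MeasurableSpace Ω] (P : Measure Ω) [IsProbabilityMeasure P]
    (X : ℕ → Ω → CC) (hX : ∀ n, IsContGaussian P (X n))
    (hX0 : ∀ n, ∀ᵐ ω ∂P, X n ω ⟨0, Set.left_mem_Icc.mpr zero_le_one⟩ = 0)
    (γ : ℕ → ℝ) (hγ : Tendsto γ atTop atTop)
    (m : ℕ → UI → ℝ) (hm : ∀ n t, m n t = ∫ ω, X n ω t ∂P)
    (k : ℕ → UI → UI → ℝ)
    (hk : ∀ n t s, k n t s = ∫ ω, (X n ω t - m n t) * (X n ω s - m n s) ∂P)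
    (α M1 M2 : ℝ) (hαpos : 0 < α) (hM1 : 0 < M1) (hM2 : 0 < M2)
    (hmean : ∀ (n : ℕ) (s t : UI), s ≠ t →
      |m n t - m n s| ≤ M1 * |(t : ℝ) - (s : ℝ)| ^ α)
    (hcov : ∀ (n : ℕ) (s t : UI), s ≠ t →
      γ n * |k n t t + k n s s - 2 * k n s t| ≤ M2 * |(t : ℝ) - (s : ℝ)| ^ (2 * α)) :
    ExpTight P X γ := by
  intro R hR
  have hr1 : (1/2:ℝ)^α < 1 := Real.rpow_lt_one (by norm_num) (by norm_num) hαpos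
  have hr0 : 0 < (1/2:ℝ)^α := by positivity
  refine ⟨KK fun j => (Real.sqrt (2 * M2 * (R+1)) + M1) * ((j + 1 : ℝ) * ((1/2:ℝ)^α)^j),
    KK_compact _ ?_, ?_⟩
  · apply Summable.mul_left
    have hn : ‖(1/2:ℝ)^α‖ < 1 := by rwa [Real.norm_of_nonneg hr0.le]
    have h1 := summable_pow_mul_geometric_of_norm_lt_one 1 hn
    have h2 := summable_geometric_of_lt_one hr0.le hr1
    refine (h1.add h2).congr fun j => ?_
    ring
  · refine Filter.limsup_le_of_le (by isBoundedDefault) ?_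
    filter_upwards [hγ.eventually_ge_atTop (Real.log 4)] with n hn
    have h4 : 0 < Real.log 4 := Real.log_pos (by norm_num)
    have hg : 0 < γ n := lt_of_lt_of_le h4 hn
    have he : Real.exp (-(γ n)) ≤ 1/4 := by
      rw [Real.exp_neg, one_div]
      apply inv_anti₀ (by norm_num)
      rwa [← Real.log_le_iff_le_exp (by norm_num)]
    have hle : 4 * Real.exp (-(γ n * (R+1))) ≤ Real.exp (-(γ n * R)) := by
      rw [show -(γ n * (R+1)) = -(γ n * R) + -(γ n) by ring, Real.exp_add]
      nlinarith [Real.exp_pos (-(γ n * R))]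
    have hle1 : Real.exp (-(γ n * R)) ≤ 1 := by
      rw [Real.exp_le_one_iff]
      have := mul_pos hg hR
      linarith
    apply elog_bound _ hg
    refine (KK_prob P (X n) (hX n) (hX0 n) (γ n) hg (m n) (hm n) (k n) (hk n) α M1 M2 hM1 hM2
      (hmean n) (hcov n) (R+1) (by linarith) (by linarith)).trans ?_
    exact ENNReal.ofReal_le_ofReal hle

end
end

section
/- Let α>0 and suppose (Xⁿ) satisfies hypothesis (G) at speed γ(n) with limit kernel k̄. Let y = (y₁,y₂) ∈ C_α×C. Then the family of continuous Gaussian processes (y₁Xⁿ + y₂), i.e. t ↦ y₁(t)Xⁿ(t) + y₂(t), is exponentially tight at speed γ(n), satisfies limₙ E[⟨λ, y₁Xⁿ+y₂⟩] = ⟨λ,y₂⟩ and limₙ γ(n)·Var(⟨λ, y₁Xⁿ+y₂⟩) = ∫₀¹∫₀¹ k^{y₁}(t,s) dλ(t)dλ(s) for every λ ∈ M[0,1], where k^{y₁}(s,t) = y₁(s)y₁(t)k̄(s,t), and it satisfies an LDP on C with speed γ(n) and good rate function z ↦ Λ*_{k̄}((z−y₂)/y₁). -/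
open MeasureTheory ProbabilityTheory Filter Topology
open scoped ENNReal NNReal

noncomputable section

/-! ### Pairing of signed measures with continuous functions -/

lemma integrable_cont (μ : Measure UI) [IsFiniteMeasure μ] {h : UI → ℝ} (hh : Continuous h) :
    Integrable h μ :=
  integrableOn_univ.mp (hh.continuousOn.integrableOn_compact isCompact_univ)

/-- The pairing can be computed from any decomposition as a difference of finite measures. -/
lemma pairSM_sub (μ ν : Measure UI) [IsFiniteMeasure μ] [IsFiniteMeasure ν] {h : UI → ℝ}
    (hh : Continuous h) :
    pairSM (μ.toSignedMeasure - ν.toSignedMeasure) h = ∫ t, h t ∂μ - ∫ t, h t ∂ν := by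
  set lam := μ.toSignedMeasure - ν.toSignedMeasure with hlam
  set p := lam.toJordanDecomposition.posPart with hp
  set q := lam.toJordanDecomposition.negPart with hq
  have h1 : p.toSignedMeasure - q.toSignedMeasure = μ.toSignedMeasure - ν.toSignedMeasure := by
    have := SignedMeasure.toSignedMeasure_toJordanDecomposition lam
    rw [JordanDecomposition.toSignedMeasure] at this
    exact this
  have h2 : (p + ν).toSignedMeasure = (μ + q).toSignedMeasure := by
    rw [Measure.toSignedMeasure_add, Measure.toSignedMeasure_add]
    have := sub_eq_sub_iff_add_eq_add.mp h1
    exact this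
  have h3 : p + ν = μ + q := Measure.toSignedMeasure_eq_toSignedMeasure_iff.mp h2
  have h4 : ∫ t, h t ∂(p + ν) = ∫ t, h t ∂(μ + q) := by rw [h3]
  rw [integral_add_measure (integrable_cont _ hh) (integrable_cont _ hh),
    integral_add_measure (integrable_cont _ hh) (integrable_cont _ hh)] at h4
  unfold pairSM
  rw [← hp, ← hq]
  linarith

lemma pairSM_add (lam : SignedMeasure UI) {f g : UI → ℝ} (hf : Continuous f) (hg : Continuous g) :
    pairSM lam (fun t => f t + g t) = pairSM lam f + pairSM lam g := by
  unfold pairSM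
  rw [integral_add (integrable_cont _ hf) (integrable_cont _ hg),
    integral_add (integrable_cont _ hf) (integrable_cont _ hg)]
  ring

lemma continuous_integral_param (μ : Measure UI) [IsFiniteMeasure μ] {k : UI → UI → ℝ}
    (hk : Continuous fun p : UI × UI => k p.1 p.2) :
    Continuous fun t => ∫ s, k t s ∂μ := by
  have := continuous_parametric_integral_of_continuous (μ := μ) (f := k) (by exact hk)
    (isCompact_univ (X := UI))
  simpa using this

lemma continuous_pairSM_param (lam : SignedMeasure UI) {k : UI → UI → ℝ}
    (hk : Continuous fun p : UI × UI => k p.1 p.2) :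
    Continuous fun t => pairSM lam (fun s => k t s) :=
  (continuous_integral_param _ hk).sub (continuous_integral_param _ hk)

lemma continuous_integral_CC (μ : Measure UI) [IsFiniteMeasure μ] :
    Continuous fun z : CC => ∫ t, z t ∂μ := by
  refine (LipschitzWith.of_dist_le_mul (K := (μ Set.univ).toNNReal) fun z w => ?_).continuous
  rw [dist_eq_norm, ← integral_sub (integrable_cont _ z.continuous)
    (integrable_cont _ w.continuous)]
  have := norm_integral_le_of_norm_le_const (μ := μ) (f := fun t => z t - w t) (C := dist z w)
    (Eventually.of_forall fun t => by
      rw [← dist_eq_norm]; exact ContinuousMap.dist_apply_le_dist t)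
  rw [mul_comm]
  exact this

lemma continuous_pairSM (lam : SignedMeasure UI) : Continuous fun z : CC => pairSM lam z :=
  (continuous_integral_CC _).sub (continuous_integral_CC _)

/-- The signed measure `y·lam`, for a nonnegative continuous density `y`. -/
lemma exists_densSM (y : CC) (hy : ∀ t, 0 ≤ y t) (lam : SignedMeasure UI) :
    ∃ lam' : SignedMeasure UI, ∀ h : UI → ℝ, Continuous h →
      pairSM lam' h = pairSM lam (fun t => y t * h t) := by
  have hm : Measurable fun t => (y t).toNNReal := by fun_prop
  have hfin : ∀ μ : Measure UI, IsFiniteMeasure μ →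
      IsFiniteMeasure (μ.withDensity fun t => ((y t).toNNReal : ℝ≥0∞)) := by
    intro μ hμ
    exact isFiniteMeasure_withDensity_ofReal (integrable_cont μ y.continuous).2
  have := hfin lam.toJordanDecomposition.posPart inferInstance
  have := hfin lam.toJordanDecomposition.negPart inferInstance
  refine ⟨(lam.toJordanDecomposition.posPart.withDensity
      fun t => ((y t).toNNReal : ℝ≥0∞)).toSignedMeasure -
    (lam.toJordanDecomposition.negPart.withDensity
      fun t => ((y t).toNNReal : ℝ≥0∞)).toSignedMeasure, fun h hh => ?_⟩
  rw [pairSM_sub _ _ hh, integral_withDensity_eq_integral_smul hm,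
    integral_withDensity_eq_integral_smul hm]
  unfold pairSM
  simp only [NNReal.smul_def, Real.coe_toNNReal _ (hy _), smul_eq_mul]

/-- Finitely supported signed measures. -/
lemma exists_finSM {ι : Type*} [Fintype ι] (t : ι → UI) (c : ι → ℝ) :
    ∃ lam : SignedMeasure UI, ∀ h : UI → ℝ, Continuous h →
      pairSM lam h = ∑ i, c i * h (t i) := by
  have key : ∀ (c : ι → ℝ≥0) (h : UI → ℝ), Continuous h →
      ∫ s, h s ∂(∑ i, c i • Measure.dirac (t i)) = ∑ i, (c i : ℝ) * h (t i) := by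
    intro c h hh
    rw [integral_finsetSum_measure (fun i _ => integrable_cont _ hh)]
    refine Finset.sum_congr rfl fun i _ => ?_
    rw [integral_smul_nnreal_measure, integral_dirac, NNReal.smul_def, smul_eq_mul]
  refine ⟨(∑ i, (c i).toNNReal • Measure.dirac (t i)).toSignedMeasure -
    (∑ i, (-c i).toNNReal • Measure.dirac (t i)).toSignedMeasure, fun h hh => ?_⟩
  rw [pairSM_sub _ _ hh, key _ _ hh, key _ _ hh, ← Finset.sum_sub_distrib]
  refine Finset.sum_congr rfl fun i _ => ?_
  rw [← sub_mul, Real.coe_toNNReal', Real.coe_toNNReal']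
  congr 1
  rcases le_total 0 (c i) with h | h
  · rw [max_eq_left h, max_eq_right (by linarith)]; ring
  · rw [max_eq_right h, max_eq_left (by linarith)]; ring

/-! ### Exponential estimates versus the extended logarithm -/

lemma elog_le_iff {g : ℝ} (hg : 0 < g) (x : ℝ≥0∞) (a : ℝ) :
    ((g⁻¹ : ℝ) : EReal) * elog x ≤ (a : EReal) ↔ x ≤ ENNReal.ofReal (Real.exp (g * a)) := by
  have hg' : 0 < g⁻¹ := inv_pos.mpr hg
  unfold elog
  split_ifs with h0 h1
  · subst h0
    simp [EReal.coe_mul_bot_of_pos hg']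
  · subst h1
    simp [EReal.coe_mul_top_of_pos hg']
  · have hx : 0 < x.toReal := ENNReal.toReal_pos h0 h1
    rw [← EReal.coe_mul, EReal.coe_le_coe_iff, ← ENNReal.toReal_le_toReal h1 ENNReal.ofReal_ne_top,
      ENNReal.toReal_ofReal (Real.exp_pos _).le, ← Real.log_le_iff_le_exp hx, inv_mul_le_iff₀ hg]

lemma le_elog_iff {g : ℝ} (hg : 0 < g) (x : ℝ≥0∞) (a : ℝ) :
    (a : EReal) ≤ ((g⁻¹ : ℝ) : EReal) * elog x ↔ ENNReal.ofReal (Real.exp (g * a)) ≤ x := by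
  have hg' : 0 < g⁻¹ := inv_pos.mpr hg
  unfold elog
  split_ifs with h0 h1
  · subst h0
    simp [EReal.coe_mul_bot_of_pos hg', Real.exp_pos]
  · subst h1
    simp [EReal.coe_mul_top_of_pos hg']
  · have hx : 0 < x.toReal := ENNReal.toReal_pos h0 h1
    rw [← EReal.coe_mul, EReal.coe_le_coe_iff, ← ENNReal.toReal_le_toReal ENNReal.ofReal_ne_top h1,
      ENNReal.toReal_ofReal (Real.exp_pos _).le, ← Real.le_log_iff_exp_le hx, le_inv_mul_iff₀ hg]

/-- A constant is eventually absorbed by the exponential speed. -/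
lemma eventually_const_absorb {γ : ℕ → ℝ} (hγ : Tendsto γ atTop atTop) (C : ℝ) {a b : ℝ}
    (hab : a < b) : ∀ᶠ n in atTop, C * Real.exp (γ n * a) ≤ Real.exp (γ n * b) := by
  have h1 : Tendsto (fun n => Real.exp (γ n * (b - a))) atTop atTop :=
    Real.tendsto_exp_atTop.comp (hγ.atTop_mul_const (by linarith))
  filter_upwards [h1.eventually_ge_atTop C] with n hn
  have : Real.exp (γ n * b) = Real.exp (γ n * (b - a)) * Real.exp (γ n * a) := by
    rw [← Real.exp_add]; ring_nf
  rw [this]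
  gcongr

lemma limsup_le_of_bound {γ : ℕ → ℝ} (hγ : Tendsto γ atTop atTop) {u : ℕ → ℝ≥0∞} {a C : ℝ}
    (h : ∀ᶠ n in atTop, u n ≤ ENNReal.ofReal (C * Real.exp (γ n * a))) :
    limsup (fun n => (((γ n)⁻¹ : ℝ) : EReal) * elog (u n)) atTop ≤ (a : EReal) := by
  refine EReal.le_of_forall_lt_iff_le.mp fun b hb => ?_
  have hab : a < b := by exact_mod_cast hb
  refine limsup_le_of_le (by isBoundedDefault) ?_
  filter_upwards [h, eventually_const_absorb hγ C hab, hγ.eventually_gt_atTop 0] with n h1 h2 h3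
  rw [elog_le_iff h3]
  exact h1.trans (ENNReal.ofReal_le_ofReal h2)

lemma bound_of_limsup_le {γ : ℕ → ℝ} (hγ : Tendsto γ atTop atTop) {u : ℕ → ℝ≥0∞} {a b : ℝ}
    (hab : a < b)
    (h : limsup (fun n => (((γ n)⁻¹ : ℝ) : EReal) * elog (u n)) atTop ≤ (a : EReal)) :
    ∀ᶠ n in atTop, u n ≤ ENNReal.ofReal (Real.exp (γ n * b)) := by
  have h1 := eventually_lt_of_limsup_lt (h.trans_lt (EReal.coe_lt_coe_iff.mpr hab))
    (by isBoundedDefault)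
  filter_upwards [h1, hγ.eventually_gt_atTop 0] with n h2 h3
  exact (elog_le_iff h3 _ _).mp h2.le

lemma le_liminf_of_bound {γ : ℕ → ℝ} (hγ : Tendsto γ atTop atTop) {u : ℕ → ℝ≥0∞} {a : ℝ}
    (h : ∀ᶠ n in atTop, ENNReal.ofReal (Real.exp (γ n * a)) ≤ u n) :
    (a : EReal) ≤ liminf (fun n => (((γ n)⁻¹ : ℝ) : EReal) * elog (u n)) atTop := by
  refine le_liminf_of_le (by isBoundedDefault) ?_
  filter_upwards [h, hγ.eventually_gt_atTop 0] with n h1 h3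
  exact (le_elog_iff h3 _ _).mpr h1

/-! ### Gaussian exponential moments -/

lemma gauss_mgf {Ω : Type*} [MeasurableSpace Ω] (P : Measure Ω) [IsProbabilityMeasure P]
    {X : Ω → CC} (hX : IsContGaussian P X) (hc : IsCentered P X) (lam : SignedMeasure UI) (g : ℝ) :
    Integrable (fun ω => Real.exp (g * pairSM lam (X ω))) P ∧
    ∫ ω, Real.exp (g * pairSM lam (X ω)) ∂P =
      Real.exp (g ^ 2 * variance (fun ω => pairSM lam (X ω)) P / 2) := by
  obtain ⟨m, v, hv⟩ := hX.2 lam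
  set Y : Ω → ℝ := fun ω => pairSM lam (X ω) with hY
  have hYm : Measurable Y := (continuous_pairSM lam).measurable.comp hX.1
  have hm : m = 0 := by
    have h1 : ∫ ω, Y ω ∂P = 0 := hc lam
    have h2 : ∫ x, x ∂(P.map Y) = ∫ ω, Y ω ∂P :=
      integral_map hYm.aemeasurable aestronglyMeasurable_id
    rw [hv, integral_id_gaussianReal, h1] at h2
    exact h2
  have hvar : variance Y P = v := by
    have h2 : variance id (P.map Y) = variance (id ∘ Y) P :=
      variance_map aemeasurable_id hYm.aemeasurable
    rw [hv, variance_id_gaussianReal] at h2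
    simpa using h2.symm
  constructor
  · have h1 : Integrable (fun x => Real.exp (g * x)) (P.map Y) := by
      rw [hv]; exact integrable_exp_mul_gaussianReal g
    exact h1.comp_measurable hYm
  · have := mgf_gaussianReal hv g
    rw [hvar, hm] at *
    rw [mgf] at this
    rw [this]
    congr 1
    ring

lemma integrable_pairSM {Ω : Type*} [MeasurableSpace Ω] (P : Measure Ω) [IsProbabilityMeasure P]
    {X : Ω → CC} (hX : IsContGaussian P X) (lam : SignedMeasure UI) :
    Integrable (fun ω => pairSM lam (X ω)) P := by
  obtain ⟨m, v, hv⟩ := hX.2 lam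
  have hYm : Measurable fun ω => pairSM lam (X ω) := (continuous_pairSM lam).measurable.comp hX.1
  have h1 : Integrable (fun x : ℝ => x) (P.map fun ω => pairSM lam (X ω)) := by
    rw [hv]; exact (memLp_id_gaussianReal 1).integrable (by simp)
  exact h1.comp_measurable hYm

/-- Chernoff bound for half spaces. -/
lemma chernoff {Ω : Type*} [MeasurableSpace Ω] (P : Measure Ω) [IsProbabilityMeasure P]
    {X : Ω → CC} (hX : IsContGaussian P X) (hc : IsCentered P X) (lam : SignedMeasure UI)
    {g : ℝ} (hg : 0 < g) (a : ℝ) :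
    P.real {ω | a ≤ pairSM lam (X ω)} ≤
      Real.exp (g * (g * variance (fun ω => pairSM lam (X ω)) P / 2 - a)) := by
  obtain ⟨hi, he⟩ := gauss_mgf P hX hc lam g
  have h := measure_ge_le_exp_mul_mgf (μ := P) (X := fun ω => pairSM lam (X ω)) a hg.le hi
  refine h.trans (le_of_eq ?_)
  rw [mgf, he, ← Real.exp_add]
  congr 1
  ring

/-- The basic tilting inequality. -/
lemma tilt {Ω κ : Type*} [MeasurableSpace Ω] [Fintype κ] (P : Measure Ω) [IsProbabilityMeasure P]
    {Y : Ω → ℝ} {W : κ → Ω → ℝ} {A : Set Ω} (hA : MeasurableSet A) {g B : ℝ} (hg : 0 < g)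
    {a : κ → ℝ} (hY : Integrable (fun ω => Real.exp (g * Y ω)) P)
    (hW : ∀ d, Integrable (fun ω => Real.exp (g * W d ω)) P)
    (h1 : ∀ ω ∈ A, Y ω ≤ B) (h2 : ∀ ω ∉ A, ∃ d, Y ω ≤ W d ω - a d) :
    ∫ ω, Real.exp (g * Y ω) ∂P ≤ Real.exp (g * B) * P.real A +
      ∑ d, Real.exp (-(g * a d)) * ∫ ω, Real.exp (g * W d ω) ∂P := by
  have hi1 : Integrable (A.indicator fun _ => Real.exp (g * B)) P :=
    (integrable_const _).indicator hA
  have hi2 : Integrable (fun ω => ∑ d, Real.exp (-(g * a d)) * Real.exp (g * W d ω)) P :=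
    integrable_finsetSum _ fun d _ => (hW d).const_mul _
  have hle : ∫ ω, Real.exp (g * Y ω) ∂P ≤ ∫ ω, (A.indicator (fun _ => Real.exp (g * B)) ω +
      ∑ d, Real.exp (-(g * a d)) * Real.exp (g * W d ω)) ∂P := by
    refine integral_mono hY (hi1.add hi2) fun ω => ?_
    have hpos : 0 ≤ ∑ d, Real.exp (-(g * a d)) * Real.exp (g * W d ω) :=
      Finset.sum_nonneg fun d _ => by positivity
    by_cases hω : ω ∈ A
    · simp only [Set.indicator_of_mem hω]
      have : Real.exp (g * Y ω) ≤ Real.exp (g * B) := by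
        gcongr; exact h1 ω hω
      linarith
    · simp only [Set.indicator_of_notMem hω, zero_add]
      obtain ⟨d, hd⟩ := h2 ω hω
      refine le_trans ?_ (Finset.single_le_sum (f := fun d => Real.exp (-(g * a d)) *
        Real.exp (g * W d ω)) (fun d _ => by positivity) (Finset.mem_univ d))
      simp only [← Real.exp_add]
      gcongr
      nlinarith
  refine hle.trans (le_of_eq ?_)
  rw [integral_add hi1 hi2, integral_finsetSum _ fun d _ => (hW d).const_mul _,
    integral_indicator_const _ hA, smul_eq_mul, mul_comm]
  simp only [integral_const_mul]

lemma dblInt_fin {ι : Type*} [Fintype ι] {t : ι → UI} {c : ι → ℝ} {lam : SignedMeasure UI}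
    (hlam : ∀ h : UI → ℝ, Continuous h → pairSM lam h = ∑ i, c i * h (t i))
    {k : UI → UI → ℝ} (hk : Continuous fun p : UI × UI => k p.1 p.2) :
    dblInt lam k = ∑ i, c i * ∑ j, c j * k (t i) (t j) := by
  unfold dblInt
  rw [hlam _ (continuous_pairSM_param lam hk)]
  refine Finset.sum_congr rfl fun i _ => ?_
  rw [hlam]
  exact hk.comp (by fun_prop : Continuous fun s : UI => (t i, s))

/-- Lower bound on cylinders. -/
lemma cyl_lower {Ω : Type*} [MeasurableSpace Ω] (P : Measure Ω) [IsProbabilityMeasure P]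
    {γ : ℕ → ℝ} (hγ : Tendsto γ atTop atTop) {X : ℕ → Ω → CC} {k : UI → UI → ℝ}
    (hX : ∀ n, IsContGaussian P (X n)) (hc : ∀ n, IsCentered P (X n))
    (hk : Continuous fun p : UI × UI => k p.1 p.2) (hsymm : ∀ s t, k s t = k t s)
    (hvar : ∀ lam : SignedMeasure UI,
      Tendsto (fun n => γ n * variance (fun ω => pairSM lam (X n ω)) P) atTop
        (nhds (dblInt lam k)))
    {ι : Type*} [Fintype ι] (t : ι → UI) (c h : ι → ℝ)
    (hch : ∀ i, ∑ j, c j * k (t i) (t j) = h i) {ε b : ℝ} (hε : 0 < ε)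
    (hb : (∑ i, c i * h i) / 2 + ε * ∑ i, |c i| < b) :
    ∀ᶠ n in atTop, Real.exp (γ n * (-b)) ≤ P.real {ω | ∀ i, |X n ω (t i) - h i| < ε} := by
  classical
  set S := ∑ i, c i * h i with hS
  obtain ⟨lam, hlam⟩ := exists_finSM t c
  have hQ : dblInt lam k = S := by
    rw [dblInt_fin hlam hk]; simp only [hch]; rfl
  let sg : Bool → ℝ := fun b => if b then 1 else -1
  have hsg : ∀ b, sg b * sg b = 1 := by intro b; cases b <;> simp [sg]
  let s : ι → ℝ := fun i => ε / (|k (t i) (t i)| + 1)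
  have hs : ∀ i, 0 < s i := fun i => by positivity
  have hsk : ∀ i, s i * k (t i) (t i) ≤ ε := by
    intro i
    have h1 : s i * (|k (t i) (t i)| + 1) = ε := by
      simp only [s]; field_simp
    have := le_abs_self (k (t i) (t i))
    nlinarith [hs i]
  have hex : ∀ d : ι × Bool, ∃ lam' : SignedMeasure UI,
      (∀ f : UI → ℝ, Continuous f →
        pairSM lam' f = pairSM lam f + s d.1 * sg d.2 * f (t d.1)) ∧
      dblInt lam' k = S + 2 * (s d.1 * sg d.2) * h d.1 + (s d.1) ^ 2 * k (t d.1) (t d.1) := by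
    intro d
    set r := s d.1 * sg d.2 with hr
    obtain ⟨lam', hlam'⟩ := exists_finSM t (fun i => c i + if i = d.1 then r else 0)
    have hp : ∀ f : ι → ℝ, ∑ i, (c i + if i = d.1 then r else 0) * f i =
        ∑ i, c i * f i + r * f d.1 := by
      intro f
      simp [add_mul, Finset.sum_add_distrib]
    refine ⟨lam', fun f hf => ?_, ?_⟩
    · rw [hlam' f hf, hlam f hf, hp fun i => f (t i)]
    · rw [dblInt_fin hlam' hk, hp]
      simp only [hp fun j => k _ (t j), hch, mul_add, Finset.sum_add_distrib]
      have h3 : ∑ i, c i * (r * k (t i) (t d.1)) = r * h d.1 := by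
        rw [← hch d.1, Finset.mul_sum]
        refine Finset.sum_congr rfl fun i _ => ?_
        rw [hsymm]; ring
      have h4 : r * r = s d.1 ^ 2 := by
        rw [hr]; linear_combination (s d.1 ^ 2) * hsg d.2
      rw [h3, ← hS]
      linear_combination k (t d.1) (t d.1) * h4
  choose lam' hlam1 hlam2 using hex
  let a : ι × Bool → ℝ := fun d => s d.1 * (sg d.2 * h d.1 + ε)
  -- the pointwise inequality
  have key : ∀ n, 0 < γ n →
      Real.exp (γ n * (γ n * variance (fun ω => pairSM lam (X n ω)) P / 2)) ≤
      Real.exp (γ n * (S + ε * ∑ i, |c i|)) * P.real {ω | ∀ i, |X n ω (t i) - h i| < ε} +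
      ∑ d, Real.exp (γ n * (γ n * variance (fun ω => pairSM (lam' d) (X n ω)) P / 2 - a d)) := by
    intro n hn
    have hmeas : MeasurableSet {ω | ∀ i, |X n ω (t i) - h i| < ε} := by
      rw [Set.ofPred_forall]
      refine MeasurableSet.iInter fun i => ?_
      have : IsOpen {z : CC | |z (t i) - h i| < ε} := by
        refine isOpen_lt ?_ continuous_const
        have := continuous_eval_const (F := CC) (t i)
        fun_prop
      exact (hX n).1 this.measurableSet
    have := tilt P (Y := fun ω => pairSM lam (X n ω)) (W := fun d ω => pairSM (lam' d) (X n ω))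
      (A := {ω | ∀ i, |X n ω (t i) - h i| < ε}) hmeas (g := γ n) (B := S + ε * ∑ i, |c i|) hn
      (a := a) (gauss_mgf P (hX n) (hc n) _ _).1 (fun d => (gauss_mgf P (hX n) (hc n) _ _).1)
      ?_ ?_
    · rw [(gauss_mgf P (hX n) (hc n) _ _).2] at this
      simp only [(gauss_mgf P (hX n) (hc n) _ _).2, ← Real.exp_add] at this
      refine le_of_eq_of_le ?_ (this.trans_eq ?_)
      · ring_nf
      · congr 1
        refine Finset.sum_congr rfl fun d _ => ?_
        congr 1; ring
    · intro ω hω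
      rw [hlam _ (X n ω).continuous, hS, Finset.mul_sum, ← Finset.sum_add_distrib]
      refine Finset.sum_le_sum fun i _ => ?_
      have h1 := hω i
      have h2 : c i * (X n ω (t i) - h i) ≤ |c i| * |X n ω (t i) - h i| := by
        rw [← abs_mul]; exact le_abs_self _
      have h3 := mul_le_mul_of_nonneg_left h1.le (abs_nonneg (c i))
      nlinarith
    · intro ω hω
      simp only [Set.mem_ofPred_eq, not_forall, not_lt] at hω
      obtain ⟨i, hi⟩ := hω
      rcases le_abs.mp hi with hi | hi
      · refine ⟨(i, true), ?_⟩
        simp only [hlam1 _ _ (X n ω).continuous, a, sg]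
        simp
        nlinarith [hs i]
      · refine ⟨(i, false), ?_⟩
        simp only [hlam1 _ _ (X n ω).continuous, a, sg]
        simp
        nlinarith [hs i]
  -- the limits
  have hbad : ∀ d, ∀ᶠ δ in 𝓝[>] (0:ℝ), ∀ᶠ n in atTop,
      γ n * variance (fun ω => pairSM (lam' d) (X n ω)) P / 2 - a d < S / 2 - 2 * δ := by
    intro d
    have h1 : ∀ᶠ δ in 𝓝[>] (0:ℝ), δ < s d.1 * ε / 4 :=
      (eventually_lt_nhds (by have := hs d.1; positivity)).filter_mono nhdsWithin_le_nhds
    filter_upwards [h1] with δ hδ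
    have h2 := ((hvar (lam' d)).div_const 2).sub_const (a d)
    refine h2.eventually_lt_const ?_
    rw [hlam2]
    have := hsk d.1
    simp only [a]
    nlinarith [hs d.1]
  have hδ : ∀ᶠ δ in 𝓝[>] (0:ℝ), 0 < δ ∧ 2 * δ < b - (S / 2 + ε * ∑ i, |c i|) ∧
      ∀ d, ∀ᶠ n in atTop,
      γ n * variance (fun ω => pairSM (lam' d) (X n ω)) P / 2 - a d < S / 2 - 2 * δ := by
    have h0 : ∀ᶠ δ in 𝓝[>] (0:ℝ), 0 < δ := self_mem_nhdsWithin
    have h1 : ∀ᶠ δ in 𝓝[>] (0:ℝ), δ < (b - (S / 2 + ε * ∑ i, |c i|)) / 2 :=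
      (eventually_lt_nhds (by linarith)).filter_mono nhdsWithin_le_nhds
    filter_upwards [h0, h1, eventually_all.mpr hbad] with δ h0 h1 h2
    exact ⟨h0, by linarith, h2⟩
  obtain ⟨δ, hδ0, hδb, hδn⟩ := hδ.exists
  have hgood : ∀ᶠ n in atTop, S / 2 - δ < γ n * variance (fun ω => pairSM lam (X n ω)) P / 2 := by
    refine ((hvar lam).div_const 2).eventually_const_lt ?_
    rw [hQ]; linarith
  filter_upwards [hγ.eventually_gt_atTop 0, hgood, eventually_all.mpr hδn,
    eventually_const_absorb hγ (2 * Fintype.card (ι × Bool)) (show S / 2 - 2 * δ < S / 2 - δ by linarith),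
    eventually_const_absorb hγ 2 (show -b < S / 2 - δ - (S + ε * ∑ i, |c i|) by linarith)]
    with n hn h1 h2 h3 h4
  have hk1 := key n hn
  have hk2 : Real.exp (γ n * (S / 2 - δ)) ≤
      Real.exp (γ n * (γ n * variance (fun ω => pairSM lam (X n ω)) P / 2)) := by
    gcongr
  have hk3 : ∑ d, Real.exp (γ n * (γ n * variance (fun ω => pairSM (lam' d) (X n ω)) P / 2 - a d))
      ≤ Fintype.card (ι × Bool) * Real.exp (γ n * (S / 2 - 2 * δ)) := by
    rw [← nsmul_eq_mul, ← Finset.card_univ]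
    refine Finset.sum_le_card_nsmul _ _ _ fun d _ => ?_
    have := h2 d
    gcongr
  set p := P.real {ω | ∀ i, |X n ω (t i) - h i| < ε}
  have hk4 : Real.exp (γ n * (S / 2 - δ)) / 2 ≤ Real.exp (γ n * (S + ε * ∑ i, |c i|)) * p := by
    linarith
  have hk5 : Real.exp (γ n * (S / 2 - δ)) = Real.exp (γ n * (S + ε * ∑ i, |c i|)) *
      Real.exp (γ n * (S / 2 - δ - (S + ε * ∑ i, |c i|))) := by
    rw [← Real.exp_add]; ring_nf
  have hE := Real.exp_pos (γ n * (S + ε * ∑ i, |c i|))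
  rw [hk5, mul_div_assoc] at hk4
  have := le_of_mul_le_mul_left hk4 hE
  linarith

/-! ### The large deviation principle for the centered family -/

lemma cramer_le {k : UI → UI → ℝ} {f : UI → ℝ} {b : ℝ} (hb : 0 ≤ b)
    (h : CramerK k f ≤ ENNReal.ofReal b) (lam : SignedMeasure UI) :
    pairSM lam f - LamK k lam ≤ b :=
  (ENNReal.ofReal_le_ofReal_iff hb).mp ((le_iSup (fun lam : SignedMeasure UI =>
    ENNReal.ofReal (pairSM lam f - LamK k lam)) lam).trans h)

/-- Solvability of a symmetric linear system. -/
lemma exists_solution {ι : Type*} [Fintype ι] (A : ι → ι → ℝ) (hA : ∀ i j, A i j = A j i)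
    (h : ι → ℝ) (hker : ∀ c : ι → ℝ, (∀ i, ∑ j, c j * A i j = 0) → ∑ i, c i * h i = 0) :
    ∃ c : ι → ℝ, ∀ i, ∑ j, c j * A i j = h i := by
  classical
  let M : Matrix ι ι ℝ := Matrix.of A
  have hM : M.IsHermitian := by
    ext i j; simp [M, hA i j]
  have hsym : M.toEuclideanLin.IsSymmetric := Matrix.isSymmetric_toEuclideanLin_iff.mpr hM
  have happ : ∀ (v : EuclideanSpace ℝ ι) i, M.toEuclideanLin v i = ∑ j, v j * A i j := by
    intro v i
    simp [M, Matrix.toLpLin_apply, Matrix.mulVec, dotProduct, mul_comm]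
  have hmem : WithLp.toLp 2 h ∈ (LinearMap.range M.toEuclideanLin)ᗮᗮ := by
    rw [hsym.orthogonal_range, Submodule.mem_orthogonal]
    intro u hu
    rw [LinearMap.mem_ker] at hu
    have h1 := hker (fun i => u i) (fun i => by rw [← happ, hu]; rfl)
    simpa [PiLp.inner_apply, mul_comm] using h1
  rw [Submodule.orthogonal_orthogonal] at hmem
  obtain ⟨v, hv⟩ := hmem
  refine ⟨fun i => v i, fun i => ?_⟩
  rw [← happ, hv]

/-- On a compact set, neighbourhoods of `h` contain cylinder neighbourhoods. -/
lemma cyl_nhds {K U : Set CC} (hK : IsCompact K) (hU : IsOpen U) {h : CC} (hh : h ∈ U) :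
    ∃ (T : Finset UI) (ε : ℝ), 0 < ε ∧ ∀ g ∈ K, (∀ t ∈ T, |g t - h t| < ε) → g ∈ U := by
  classical
  have hc : IsCompact (K \ U) := hK.diff hU
  have : ∃ (T : Finset UI) (ε : ℝ), 0 < ε ∧ ∀ g ∈ K \ U, ¬ ∀ t ∈ T, |g t - h t| < ε := by
    refine hc.induction_on (p := fun S => ∃ (T : Finset UI) (ε : ℝ), 0 < ε ∧
      ∀ g ∈ S, ¬ ∀ t ∈ T, |g t - h t| < ε) ?_ ?_ ?_ ?_
    · exact ⟨∅, 1, one_pos, by simp⟩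
    · rintro s t hst ⟨T, ε, hε, H⟩
      exact ⟨T, ε, hε, fun g hg => H g (hst hg)⟩
    · rintro s t ⟨T, ε, hε, H⟩ ⟨T', ε', hε', H'⟩
      refine ⟨T ∪ T', min ε ε', lt_min hε hε', fun g hg hall => ?_⟩
      rcases hg with hg | hg
      · exact H g hg fun t ht => (hall t (Finset.mem_union_left _ ht)).trans_le (min_le_left _ _)
      · exact H' g hg fun t ht => (hall t (Finset.mem_union_right _ ht)).trans_le (min_le_right _ _)
    · intro g hg
      have hne : g ≠ h := fun e => hg.2 (e ▸ hh)
      obtain ⟨t, ht⟩ : ∃ t, g t ≠ h t := by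
        by_contra hcon
        push Not at hcon
        exact hne (ContinuousMap.ext hcon)
      have hpos : 0 < |g t - h t| := abs_pos.mpr (sub_ne_zero.mpr ht)
      refine ⟨{z : CC | |g t - h t| / 2 < |z t - h t|}, mem_nhdsWithin_of_mem_nhds ?_,
        {t}, |g t - h t| / 2, by positivity, fun z hz hall => ?_⟩
      · refine IsOpen.mem_nhds ?_ ?_
        · have := continuous_eval_const (F := CC) t
          exact isOpen_lt continuous_const (by fun_prop)
        · change |g t - h t| / 2 < |g t - h t|
          linarith
      · have h1 := hall t (Finset.mem_singleton_self t)
        have h2 : |g t - h t| / 2 < |z t - h t| := hz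
        linarith
  obtain ⟨T, ε, hε, H⟩ := this
  refine ⟨T, ε, hε, fun g hg hall => ?_⟩
  by_contra hcon
  exact H g ⟨hg, hcon⟩ hall

lemma ldp_lower {Ω : Type*} [MeasurableSpace Ω] (P : Measure Ω) [IsProbabilityMeasure P]
    {γ : ℕ → ℝ} (hγ : Tendsto γ atTop atTop) {X : ℕ → Ω → CC} {k : UI → UI → ℝ}
    (hG : HypG P X γ k) :
    LDPLower (fun n => P.map (X n)) γ (fun z : CC => CramerK k z) := by
  obtain ⟨hX, hc, htight, ⟨hk, hsymm, -⟩, -, hvar⟩ := hG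
  intro U hU
  rw [EReal.neg_le]
  refine le_iInf₂ fun h hh => ?_
  rw [EReal.neg_le]
  rw [← EReal.ge_of_forall_gt_iff_ge]
  intro b' hb'
  obtain ⟨b, rfl⟩ : ∃ b, b' = -b := ⟨-b', by ring⟩
  have hIb : (CramerK k h : EReal) < (b : EReal) := by
    rw [EReal.coe_neg, EReal.neg_lt_neg_iff] at hb'
    exact hb'
  have hb0 : 0 < b := by
    have := (EReal.coe_ennreal_nonneg (CramerK k h)).trans_lt hIb
    exact_mod_cast this
  have hI : CramerK k h < ENNReal.ofReal b := by
    have h1 : ((ENNReal.ofReal b : ℝ≥0∞) : EReal) = (b : EReal) := by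
      rw [EReal.coe_ennreal_ofReal, max_eq_left hb0.le]
    rw [← h1] at hIb
    exact EReal.coe_ennreal_lt_coe_ennreal_iff.mp hIb
  obtain ⟨b0, hb01, hb02⟩ : ∃ b0 : ℝ, CramerK k h ≤ ENNReal.ofReal b0 ∧ 0 ≤ b0 ∧ b0 < b := by
    refine ⟨(CramerK k h).toReal, (ENNReal.ofReal_toReal hI.ne_top).ge, ENNReal.toReal_nonneg, ?_⟩
    rwa [← ENNReal.lt_ofReal_iff_toReal_lt hI.ne_top]
  have hI0 := cramer_le hb02.1 hb01
  obtain ⟨K, hK, hKn⟩ := htight (b + 1) (by linarith)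
  obtain ⟨T, ε, hε, hTε⟩ := cyl_nhds hK hU hh
  -- solve the linear system
  obtain ⟨c, hcs⟩ := exists_solution (ι := T) (fun i j => k i j) (fun i j => hsymm _ _)
    (fun i => h i) (by
      intro c hc0
      have hq : ∀ r : ℝ, r * ∑ i, c i * h i ≤ b0 := by
        intro r
        obtain ⟨lam, hlam⟩ := exists_finSM (fun i : T => (i : UI)) (fun i => r * c i)
        have h1 := hI0 lam
        rw [LamK, dblInt_fin hlam hk, hlam _ h.continuous] at h1
        simp only [mul_assoc, ← Finset.mul_sum] at h1
        simp only [hc0] at h1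
        simpa using h1
      by_contra hne
      have := hq ((b0 + 1) / ∑ i, c i * h i)
      rw [div_mul_cancel₀ _ hne] at this
      linarith)
  set S := ∑ i, c i * h i with hS
  have hSb : S / 2 ≤ b0 := by
    obtain ⟨lam, hlam⟩ := exists_finSM (fun i : T => (i : UI)) c
    have h1 := hI0 lam
    rw [LamK, dblInt_fin hlam hk, hlam _ h.continuous] at h1
    simp only [hcs] at h1
    linarith
  -- choose the radius
  obtain ⟨b1, hb11, hb12⟩ := exists_between hb02.2
  obtain ⟨ε', hε', hε'ε, hε'b⟩ : ∃ ε' : ℝ, 0 < ε' ∧ ε' ≤ ε ∧ S / 2 + ε' * ∑ i, |c i| < b1 := by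
    have hpos : 0 ≤ ∑ i, |c i| := Finset.sum_nonneg fun _ _ => abs_nonneg _
    set C := ∑ i, |c i|
    refine ⟨min ε ((b1 - b0) / (C + 1)), lt_min hε (div_pos (by linarith) (by linarith)),
      min_le_left _ _, ?_⟩
    have h1 : min ε ((b1 - b0) / (C + 1)) * C ≤ (b1 - b0) / (C + 1) * C :=
      mul_le_mul_of_nonneg_right (min_le_right _ _) hpos
    have h2 : (b1 - b0) / (C + 1) * C < b1 - b0 := by
      rw [div_mul_eq_mul_div, div_lt_iff₀ (by linarith)]
      nlinarith
    linarith
  have hcyl := cyl_lower P hγ hX hc hk hsymm hvar (fun i : T => (i : UI)) c (fun i => h i) hcs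
    hε' hε'b
  have hKb := bound_of_limsup_le hγ (show -(b + 1) < -b by linarith) hKn
  refine le_liminf_of_bound hγ ?_
  filter_upwards [hcyl, hKb, eventually_const_absorb hγ 2 (show -b < -b1 by linarith)]
    with n h1 h2 h3
  rw [Measure.map_apply (hX n).1 hU.measurableSet]
  have h4 : P.real (X n ⁻¹' Kᶜ) ≤ Real.exp (γ n * (-b)) := by
    rw [measureReal_def]
    exact ENNReal.toReal_le_of_le_ofReal (Real.exp_pos _).le h2
  have h5 : P.real {ω | ∀ i : T, |X n ω i - h i| < ε'} ≤
      P.real (X n ⁻¹' U) + P.real (X n ⁻¹' Kᶜ) := by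
    refine le_trans (measureReal_mono ?_) (measureReal_union_le _ _)
    intro ω hω
    by_cases hωK : X n ω ∈ K
    · left
      exact hTε _ hωK fun t ht => (hω ⟨t, ht⟩).trans_le hε'ε
    · right; exact hωK
  rw [ENNReal.ofReal_le_iff_le_toReal (measure_ne_top _ _), ← measureReal_def]
  linarith

lemma ldp_upper {Ω : Type*} [MeasurableSpace Ω] (P : Measure Ω) [IsProbabilityMeasure P]
    {γ : ℕ → ℝ} (hγ : Tendsto γ atTop atTop) {X : ℕ → Ω → CC} {k : UI → UI → ℝ}
    (hG : HypG P X γ k) :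
    LDPUpper (fun n => P.map (X n)) γ (fun z : CC => CramerK k z) := by
  obtain ⟨hX, hc, htight, -, -, hvar⟩ := hG
  intro F hF
  rw [EReal.le_neg]
  rw [← EReal.ge_of_forall_gt_iff_ge]
  intro a ha
  rw [EReal.le_neg, ← EReal.coe_neg]
  rcases le_or_gt a 0 with ha0 | ha0
  · refine limsup_le_of_bound hγ (C := 1) ?_
    filter_upwards [hγ.eventually_gt_atTop 0] with n hn
    have : IsProbabilityMeasure (P.map (X n)) := Measure.isProbabilityMeasure_map (hX n).1.aemeasurable
    refine prob_le_one.trans ?_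
    rw [ENNReal.one_le_ofReal, one_mul]
    apply Real.one_le_exp
    nlinarith
  have hIa : ∀ x ∈ F, ENNReal.ofReal a < CramerK k x := by
    intro x hx
    have h1 : (a : EReal) < (CramerK k x : EReal) := ha.trans_le (iInf₂_le x hx)
    have h2 : ((ENNReal.ofReal a : ℝ≥0∞) : EReal) = (a : EReal) := by
      rw [EReal.coe_ennreal_ofReal, max_eq_left ha0.le]
    rw [← h2] at h1
    exact EReal.coe_ennreal_lt_coe_ennreal_iff.mp h1
  obtain ⟨K, hK, hKn⟩ := htight (a + 1) (by linarith)
  have hKb := bound_of_limsup_le hγ (show -(a + 1) < -a by linarith) hKn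
  have hcomp : ∃ C : ℝ, 0 ≤ C ∧ ∀ᶠ n in atTop,
      (P.map (X n)) (K ∩ F) ≤ ENNReal.ofReal (C * Real.exp (γ n * (-a))) := by
    refine (hK.inter_right hF).induction_on (p := fun S => ∃ C : ℝ, 0 ≤ C ∧ ∀ᶠ n in atTop,
      (P.map (X n)) S ≤ ENNReal.ofReal (C * Real.exp (γ n * (-a)))) ?_ ?_ ?_ ?_
    · exact ⟨0, le_rfl, by simp⟩
    · rintro s t hst ⟨C, hC, H⟩
      refine ⟨C, hC, ?_⟩
      filter_upwards [H] with n hn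
      exact (measure_mono hst).trans hn
    · rintro s t ⟨C, hC, H⟩ ⟨C', hC', H'⟩
      refine ⟨C + C', by linarith, ?_⟩
      filter_upwards [H, H'] with n hn hn'
      rw [add_mul, ENNReal.ofReal_add (by positivity) (by positivity)]
      exact (measure_union_le _ _).trans (add_le_add hn hn')
    · intro x hx
      obtain ⟨lam, hlam⟩ := lt_iSup_iff.mp (hIa x hx.2)
      have hlam' : a < pairSM lam x - LamK k lam := (ENNReal.ofReal_lt_ofReal_iff'.mp hlam).1
      obtain ⟨a', ha1, ha2⟩ := exists_between hlam'
      have hopen : IsOpen {z : CC | a' + LamK k lam < pairSM lam z} :=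
        isOpen_lt continuous_const (continuous_pairSM lam)
      refine ⟨{z : CC | a' + LamK k lam < pairSM lam z}, mem_nhdsWithin_of_mem_nhds
        (hopen.mem_nhds ?_), 1, zero_le_one, ?_⟩
      · change a' + LamK k lam < pairSM lam x
        linarith
      have hlim : ∀ᶠ n in atTop, γ n * variance (fun ω => pairSM lam (X n ω)) P / 2 <
          LamK k lam + (a' - a) := by
        refine ((hvar lam).div_const 2).eventually_lt_const ?_
        rw [LamK]; linarith
      filter_upwards [hlim, hγ.eventually_gt_atTop 0] with n h1 h2
      rw [Measure.map_apply (hX n).1 hopen.measurableSet]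
      have h3 := chernoff P (hX n) (hc n) lam h2 (a' + LamK k lam)
      have h4 : P (X n ⁻¹' {z : CC | a' + LamK k lam < pairSM lam z}) ≤
          P {ω | a' + LamK k lam ≤ pairSM lam (X n ω)} :=
        measure_mono fun ω hω => by
          have h5 : a' + LamK k lam < pairSM lam (X n ω) := hω
          exact h5.le
      refine h4.trans ?_
      rw [← ENNReal.ofReal_toReal (measure_ne_top P _), ← measureReal_def]
      refine ENNReal.ofReal_le_ofReal (h3.trans ?_)
      rw [one_mul]
      gcongr
      linarith
  obtain ⟨C, hC, hCn⟩ := hcomp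
  refine limsup_le_of_bound hγ (C := C + 1) ?_
  filter_upwards [hCn, hKb] with n h1 h2
  have h3 : (P.map (X n)) F ≤ (P.map (X n)) (K ∩ F) + (P.map (X n)) Kᶜ := by
    refine le_trans (measure_mono ?_) (measure_union_le _ _)
    intro z hz
    by_cases hzK : z ∈ K
    · exact Or.inl ⟨hzK, hz⟩
    · exact Or.inr hzK
  rw [Measure.map_apply (hX n).1 hK.isClosed.measurableSet.compl] at h3
  rw [add_mul, one_mul, ENNReal.ofReal_add (by positivity) (by positivity)]
  exact h3.trans (add_le_add h1 h2)

lemma cramer_lsc (k : UI → UI → ℝ) : LowerSemicontinuous (fun z : CC => CramerK k z) := by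
  unfold CramerK
  refine lowerSemicontinuous_iSup fun lam => Continuous.lowerSemicontinuous ?_
  exact ENNReal.continuous_ofReal.comp ((continuous_pairSM lam).sub continuous_const)

lemma cramer_good {Ω : Type*} [MeasurableSpace Ω] (P : Measure Ω) [IsProbabilityMeasure P]
    {γ : ℕ → ℝ} (hγ : Tendsto γ atTop atTop) {X : ℕ → Ω → CC} {k : UI → UI → ℝ}
    (hG : HypG P X γ k) : GoodRate (fun z : CC => CramerK k z) := by
  refine ⟨cramer_lsc k, fun a => ?_⟩
  obtain ⟨K, hK, hKn⟩ := hG.2.2.1 (a + 1) (by positivity)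
  refine hK.of_isClosed_subset ((cramer_lsc k).isClosed_preimage a) ?_
  intro z hz
  by_contra hzK
  have h1 := ldp_lower P hγ hG Kᶜ hK.isClosed.isOpen_compl
  have h2 : -(CramerK k z : EReal) ≤ ((-(a + 1) : ℝ) : EReal) := by
    refine le_trans (EReal.neg_le_neg_iff.mpr (iInf₂_le z hzK)) (h1.trans ?_)
    refine le_trans (liminf_le_limsup (by isBoundedDefault) (by isBoundedDefault)) ?_
    refine le_of_eq_of_le ?_ hKn
    congr 1
    ext n
    rw [Measure.map_apply (hG.1 n).1 hK.isClosed.measurableSet.compl]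
  rw [EReal.coe_neg, EReal.neg_le_neg_iff] at h2
  have h3 : (CramerK k z : EReal) ≤ ((a : ℝ) : EReal) := by
    have h4 : CramerK k z ≤ (a : ℝ≥0∞) := hz
    exact EReal.coe_ennreal_le_coe_ennreal_iff.mpr h4
  have h5 := h2.trans h3
  rw [EReal.coe_le_coe_iff] at h5
  linarith

/-! ### Transfer through the affine homeomorphism -/

/-- The homeomorphism `z ↦ y₁ z + y₂` of `C([0,1],ℝ)`. -/
def affHomeo (y1 y2 : CC) (h : ∀ t, y1 t ≠ 0) : CC ≃ₜ CC where
  toFun z := y1 * z + y2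
  invFun z := (⟨fun t => (y1 t)⁻¹, y1.continuous.inv₀ h⟩ : CC) * (z - y2)
  left_inv z := by
    ext t; simp [h t]
  right_inv z := by
    ext t; simp [h t]
  continuous_toFun := by fun_prop
  continuous_invFun := by fun_prop

/-- under hypothesis (G), the processes `y₁Xⁿ + y₂` are
exponentially tight, have converging means and covariances, and satisfy an LDP
with good rate function `z ↦ Λ*_{k̄}((z−y₂)/y₁)`. -/
theorem statement7 {Ω : Type*} [MeasurableSpace Ω] (P : Measure Ω) [IsProbabilityMeasure P]
    (α : ℝ) (hα : 0 < α) (γ : ℕ → ℝ) (hγ : Tendsto γ atTop atTop)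
    (X : ℕ → Ω → CC) (kbar : UI → UI → ℝ) (hG : HypG P X γ kbar)
    (y1 : CC) (hy1 : y1 ∈ Calpha α) (y2 : CC) :
    (∀ n, IsContGaussian P fun ω => y1 * X n ω + y2) ∧
      ExpTight P (fun n ω => y1 * X n ω + y2) γ ∧
      (∀ lam : MeasureTheory.SignedMeasure UI,
        Tendsto (fun n => ∫ ω, pairSM lam (⇑(y1 * X n ω + y2)) ∂P) atTop
          (nhds (pairSM lam (⇑y2)))) ∧
      (∀ lam : MeasureTheory.SignedMeasure UI,
        Tendsto (fun n => γ n * variance (fun ω => pairSM lam (⇑(y1 * X n ω + y2))) P)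
          atTop (nhds (dblInt lam fun s t => y1 s * y1 t * kbar s t))) ∧
      LDPrv P (fun n ω => y1 * X n ω + y2) γ
        (fun z : CC => CramerK kbar fun t => (z t - y2 t) / y1 t) ∧
      GoodRate (fun z : CC => CramerK kbar fun t => (z t - y2 t) / y1 t) := by
  have hX := hG.1
  have hc := hG.2.1
  have hpos : ∀ t, 0 < y1 t := fun t => hα.trans_le (hy1 t)
  have hne : ∀ t, y1 t ≠ 0 := fun t => (hpos t).ne'
  have hk := hG.2.2.2.1.1
  have hmeas : ∀ n, Measurable fun ω => y1 * X n ω + y2 := fun n =>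
    (affHomeo y1 y2 hne).continuous.measurable.comp (hX n).1
  -- the pairing with the transformed process
  have hpair : ∀ lam : SignedMeasure UI, ∃ lam' : SignedMeasure UI,
      (∀ z : CC, pairSM lam (⇑(y1 * z + y2)) = pairSM lam' z + pairSM lam y2) ∧
      dblInt lam' kbar = dblInt lam fun s t => y1 s * y1 t * kbar s t := by
    intro lam
    obtain ⟨lam', hlam'⟩ := exists_densSM y1 (fun t => (hpos t).le) lam
    refine ⟨lam', fun z => ?_, ?_⟩
    · rw [hlam' _ z.continuous]
      exact pairSM_add lam (f := fun t => y1 t * z t) (by fun_prop) y2.continuous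
    · unfold dblInt
      rw [hlam' _ (continuous_pairSM_param lam' hk)]
      congr 1
      ext s
      rw [hlam' (fun t => kbar s t) (hk.comp (by fun_prop : Continuous fun t : UI => (s, t)))]
      unfold pairSM
      simp only [mul_assoc, integral_const_mul]
      ring
  have hYm : ∀ n (lam : SignedMeasure UI), Measurable fun ω => pairSM lam (X n ω) := fun n lam =>
    (continuous_pairSM lam).measurable.comp (hX n).1
  have hI : (fun z : CC => CramerK kbar fun t => (z t - y2 t) / y1 t) =
      fun z : CC => CramerK kbar ⇑((affHomeo y1 y2 hne).symm z) := by
    ext z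
    congr 1
    ext t
    change (z t - y2 t) / y1 t = (y1 t)⁻¹ * (z t - y2 t)
    rw [div_eq_mul_inv, mul_comm]
  set Φ := affHomeo y1 y2 hne with hΦ
  have hmap : ∀ n (S : Set CC), MeasurableSet S →
      P.map (fun ω => y1 * X n ω + y2) S = P.map (X n) (Φ ⁻¹' S) := by
    intro n S hS
    rw [Measure.map_apply (hmeas n) hS, Measure.map_apply (hX n).1 (Φ.continuous.measurable hS)]
    rfl
  have hinf : ∀ S : Set CC, (⨅ x ∈ S, (CramerK kbar ⇑(Φ.symm x) : EReal)) =
      ⨅ x ∈ Φ ⁻¹' S, (CramerK kbar ⇑x : EReal) := by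
    intro S
    refine (Φ.symm.toEquiv.iInf_congr fun x => ?_)
    simp
  refine ⟨fun n => ⟨hmeas n, fun lam => ?_⟩, fun R hR => ?_, fun lam => ?_, fun lam => ?_, ?_, ?_⟩
  · obtain ⟨lam', h1, -⟩ := hpair lam
    obtain ⟨m, v, hv⟩ := (hX n).2 lam'
    refine ⟨m + pairSM lam y2, v, ?_⟩
    simp only [h1]
    rw [← gaussianReal_map_add_const, ← hv, Measure.map_map (by fun_prop) (hYm n lam')]
    rfl
  · obtain ⟨K, hK, hKn⟩ := hG.2.2.1 R hR
    refine ⟨Set.image Φ K, hK.image Φ.continuous, le_of_eq_of_le ?_ hKn⟩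
    congr 1
    ext n
    congr 3
    ext ω
    change ¬ (Φ (X n ω) ∈ Set.image Φ K) ↔ ¬ (X n ω ∈ K)
    rw [Φ.injective.mem_set_image]
  · obtain ⟨lam', h1, -⟩ := hpair lam
    have : ∀ n, ∫ ω, pairSM lam (⇑(y1 * X n ω + y2)) ∂P = pairSM lam y2 := by
      intro n
      simp only [h1]
      rw [integral_add (integrable_pairSM P (hX n) lam') (integrable_const _), hc n lam']
      simp
    simp only [this]
    exact tendsto_const_nhds
  · obtain ⟨lam', h1, h2⟩ := hpair lam
    rw [← h2]
    refine (hG.2.2.2.2.2 lam').congr fun n => ?_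
    simp only [h1]
    rw [variance_add_const (hYm n lam').aestronglyMeasurable]
  · rw [hI]
    refine ⟨(cramer_lsc kbar).comp Φ.symm.continuous, fun U hU => ?_, fun F hF => ?_⟩
    · rw [hinf]
      simp only [hmap _ U hU.measurableSet]
      exact ldp_lower P hγ hG _ (hU.preimage Φ.continuous)
    · rw [hinf]
      simp only [hmap _ F hF.measurableSet]
      exact ldp_upper P hγ hG _ (hF.preimage Φ.continuous)
  · rw [hI]
    refine ⟨(cramer_lsc kbar).comp Φ.symm.continuous, fun a => ?_⟩
    have := (cramer_good P hγ hG).2 a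
    exact Φ.symm.isCompact_preimage.mpr this

end
end

section
/- Let α>0, let k̄ be a continuous, symmetric, positive semidefinite kernel on [0,1]², let y₁ ∈ C_α, and define k^{y₁}(s,t) = y₁(s)y₁(t)k̄(s,t). Then for every z ∈ C, Λ*_{k^{y₁}}(z) = Λ*_{k̄}(z/y₁), where z/y₁ denotes the function t ↦ z(t)/y₁(t). -/
open MeasureTheory ProbabilityTheory Filter Topology
open scoped ENNReal NNReal

noncomputable section

lemma exists_weighted (f : UI → ℝ≥0) (hf : Continuous f) (lam : MeasureTheory.SignedMeasure UI) :
    ∃ mu : MeasureTheory.SignedMeasure UI, ∀ h : UI → ℝ,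
      pairSM mu h = pairSM lam (fun t => (f t : ℝ) * h t) := by
  have fin : ∀ (m : Measure UI) [IsFiniteMeasure m],
      IsFiniteMeasure (m.withDensity fun t => (f t : ℝ≥0∞)) := by
    intro m _
    obtain ⟨C, hC⟩ := (isCompact_range hf).bddAbove
    refine isFiniteMeasure_withDensity (ne_of_lt ?_)
    calc ∫⁻ t, (f t : ℝ≥0∞) ∂m ≤ ∫⁻ _, (C : ℝ≥0∞) ∂m := by
          refine lintegral_mono fun t => ?_
          exact ENNReal.coe_le_coe.mpr (hC ⟨t, rfl⟩)
      _ < ⊤ := by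
          rw [lintegral_const]
          exact ENNReal.mul_lt_top ENNReal.coe_lt_top (measure_lt_top _ _)
  let j := lam.toJordanDecomposition
  have := fin j.posPart
  have := fin j.negPart
  let J : JordanDecomposition UI :=
    { posPart := j.posPart.withDensity fun t => (f t : ℝ≥0∞)
      negPart := j.negPart.withDensity fun t => (f t : ℝ≥0∞)
      posPart_finite := fin j.posPart
      negPart_finite := fin j.negPart
      mutuallySingular := j.mutuallySingular.mono_ac
        (withDensity_absolutelyContinuous _ _) (withDensity_absolutelyContinuous _ _) }
  refine ⟨J.toSignedMeasure, fun h => ?_⟩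
  unfold pairSM
  rw [JordanDecomposition.toJordanDecomposition_toSignedMeasure]
  change (∫ t, h t ∂(j.posPart.withDensity fun t => (f t : ℝ≥0∞))) -
    (∫ t, h t ∂(j.negPart.withDensity fun t => (f t : ℝ≥0∞))) = _
  rw [integral_withDensity_eq_integral_smul hf.measurable,
    integral_withDensity_eq_integral_smul hf.measurable]
  rfl

lemma pairSM_const_mul (lam : MeasureTheory.SignedMeasure UI) (c : ℝ) (h : UI → ℝ) :
    pairSM lam (fun t => c * h t) = c * pairSM lam h := by
  unfold pairSM
  rw [integral_const_mul, integral_const_mul, mul_sub]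

lemma cramer_le_s8 (f : UI → ℝ≥0) (hf : Continuous f) (k : UI → UI → ℝ) (h : UI → ℝ) :
    CramerK (fun s t => (f s : ℝ) * f t * k s t) (fun t => f t * h t) ≤ CramerK k h := by
  refine iSup_le fun lam => ?_
  obtain ⟨mu, hmu⟩ := exists_weighted f hf lam
  refine le_iSup_of_le mu (le_of_eq ?_)
  have : dblInt mu k = dblInt lam (fun s t => (f s : ℝ) * f t * k s t) := by
    unfold dblInt
    simp only [hmu, mul_assoc, pairSM_const_mul]
  rw [LamK, LamK, this, hmu]

/-- the Cramér transform of the kernel `k^{y₁}(s,t)=y₁(s)y₁(t)k̄(s,t)`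
is `z ↦ Λ*_{k̄}(z/y₁)`. -/
theorem statement8 (α : ℝ) (hα : 0 < α) (kbar : UI → UI → ℝ) (hk : IsPSDKernel kbar)
    (y1 : CC) (hy1 : y1 ∈ Calpha α) (z : CC) :
    CramerK (fun s t => y1 s * y1 t * kbar s t) (⇑z) =
      CramerK kbar fun t => z t / y1 t := by
  have hpos : ∀ t, 0 < y1 t := fun t => lt_of_lt_of_le hα (hy1 t)
  have hne : ∀ t, y1 t ≠ 0 := fun t => (hpos t).ne'
  let f : UI → ℝ≥0 := fun t => ⟨y1 t, (hpos t).le⟩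
  have hf : Continuous f := y1.continuous.subtype_mk _
  have hf0 : ∀ t, f t ≠ 0 := fun t h => hne t (congrArg NNReal.toReal h)
  have hfc : ∀ t, (f t : ℝ) = y1 t := fun t => rfl
  refine le_antisymm ?_ ?_
  · have := cramer_le_s8 f hf kbar (fun t => z t / y1 t)
    simp only [hfc] at this
    have e : (fun t => y1 t * (z t / y1 t)) = ⇑z := by
      funext t
      have := hne t
      field_simp
    rw [e] at this
    exact this
  · have := cramer_le_s8 (fun t => (f t)⁻¹) (hf.inv₀ hf0)
      (fun s t => y1 s * y1 t * kbar s t) (fun t => z t)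
    simp only [NNReal.coe_inv, hfc] at this
    have e1 : kbar = fun s t => (y1 s)⁻¹ * (y1 t)⁻¹ * (y1 s * y1 t * kbar s t) := by
      funext s t
      have := hne t
      have := hne s
      field_simp
    have e2 : (fun t => z t / y1 t) = fun t => (y1 t)⁻¹ * z t := by
      funext t
      rw [div_eq_inv_mul]
    rw [← e1, ← e2] at this
    exact this

end
end

section
/- Let α>0 and let (Xⁿ) be a family of continuous Gaussian processes (C-valued random variables), exponentially tight at speed γ(n). Let (yⁿ) = ((y₁ⁿ,y₂ⁿ)) ⊂ C_α×C be a sequence converging uniformly to y = (y₁,y₂) ∈ C_α×C. Then the families Z̃ⁿ = y₂ⁿ + y₁ⁿXⁿ and Zⁿ = y₂ + y₁Xⁿ are exponentially equivalent at speed γ(n): for every δ>0, limsupₙ (1/γ(n)) log P(‖Z̃ⁿ − Zⁿ‖∞ > δ) = −∞. -/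
open MeasureTheory ProbabilityTheory Filter Topology
open scoped ENNReal NNReal

noncomputable section

theorem elog_mono' {a b : ℝ≥0∞} (h : a ≤ b) : elog a ≤ elog b := by
  unfold elog
  by_cases ha : a = 0
  · simp [ha]
  have hb : b ≠ 0 := fun hb => ha (le_antisymm (hb ▸ h) (zero_le))
  by_cases hbt : b = ⊤
  · simp [hbt]
  have hat : a ≠ ⊤ := ne_top_of_le_ne_top hbt h
  simp only [ha, hb, hbt, hat, if_false]
  exact EReal.coe_le_coe_iff.2
    (Real.log_le_log (ENNReal.toReal_pos ha hat) (ENNReal.toReal_mono hbt h))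

/-- exponential equivalence of `y₂ⁿ + y₁ⁿXⁿ` and `y₂ + y₁Xⁿ` when
`(y₁ⁿ,y₂ⁿ) → (y₁,y₂)` uniformly. -/
theorem statement9 {Ω : Type*} [MeasurableSpace Ω] (P : Measure Ω) [IsProbabilityMeasure P]
    (α : ℝ) (hα : 0 < α) (γ : ℕ → ℝ) (hγ : Tendsto γ atTop atTop)
    (X : ℕ → Ω → CC) (hX : ∀ n, IsContGaussian P (X n)) (htight : ExpTight P X γ)
    (y1s y2s : ℕ → CC) (y1 y2 : CC)
    (hy1s : ∀ n, y1s n ∈ Calpha α) (hy1 : y1 ∈ Calpha α)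
    (h1 : Tendsto y1s atTop (nhds y1)) (h2 : Tendsto y2s atTop (nhds y2)) :
    ∀ δ : ℝ, 0 < δ →
      (Filter.atTop.limsup fun n => (((γ n)⁻¹ : ℝ) : EReal) *
        elog (P {ω | δ < ‖(y2s n + y1s n * X n ω) - (y2 + y1 * X n ω)‖})) = ⊥ := by
  intro δ hδ
  have key : ∀ R : ℝ, 0 < R → (Filter.atTop.limsup fun n => (((γ n)⁻¹ : ℝ) : EReal) *
      elog (P {ω | δ < ‖(y2s n + y1s n * X n ω) - (y2 + y1 * X n ω)‖})) ≤ ((-R : ℝ) : EReal) := by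
    intro R hR
    obtain ⟨K, hK, hlim⟩ := htight R hR
    refine le_trans ?_ hlim
    obtain ⟨M, hMpos, hM⟩ := hK.isBounded.exists_pos_norm_le
    have e1 : ∀ᶠ n in atTop, dist (y1s n) y1 < δ / (2 * M) :=
      (Metric.tendsto_nhds.1 h1) _ (by positivity)
    have e2 : ∀ᶠ n in atTop, dist (y2s n) y2 < δ / 2 :=
      (Metric.tendsto_nhds.1 h2) _ (by positivity)
    refine Filter.limsup_le_limsup ?_
    filter_upwards [e1, e2, hγ.eventually_gt_atTop 0] with n d1 d2 hn
    refine mul_le_mul_of_nonneg_left (elog_mono' (measure_mono ?_))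
      (EReal.coe_nonneg.2 (inv_nonneg.2 hn.le))
    intro ω hω hXK
    have hω' : δ < ‖(y2s n + y1s n * X n ω) - (y2 + y1 * X n ω)‖ := hω
    have hXM := hM _ hXK
    rw [dist_eq_norm] at d1 d2
    have heq : (y2s n + y1s n * X n ω) - (y2 + y1 * X n ω)
        = (y2s n - y2) + (y1s n - y1) * X n ω := by ring
    rw [heq] at hω'
    have t1 := norm_add_le (y2s n - y2) ((y1s n - y1) * X n ω)
    have t2 := norm_mul_le (y1s n - y1) (X n ω)
    have t3 : ‖y1s n - y1‖ * ‖X n ω‖ ≤ δ / (2 * M) * M :=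
      mul_le_mul d1.le hXM (norm_nonneg _) (by positivity)
    have t4 : δ / (2 * M) * M = δ / 2 := by field_simp
    linarith
  rw [EReal.eq_bot_iff_forall_lt]
  intro x
  refine lt_of_le_of_lt (key (|x| + 1) (by positivity)) ?_
  rw [EReal.coe_lt_coe_iff]
  linarith [neg_abs_le x]

end
end

section
/- Let α>0 and let k̄ be a continuous, symmetric, positive semidefinite kernel on [0,1]². Define J(z|y₁,y₂) = Λ*_{k̄}((z−y₂)/y₁) for z ∈ C and (y₁,y₂) ∈ C_α×C. Then J is jointly lower semicontinuous: if zⁿ → z, y₁ⁿ → y₁ and y₂ⁿ → y₂ uniformly, with all y₁ⁿ, y₁ ∈ C_α, then liminfₙ J(zⁿ|y₁ⁿ,y₂ⁿ) ≥ J(z|y₁,y₂). -/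
open MeasureTheory ProbabilityTheory Filter Topology
open scoped ENNReal NNReal

noncomputable section

/-- Continuity of the integral of the quotient, by dominated convergence. -/
theorem aux_tendsto_integral (μ : Measure UI) [IsFiniteMeasure μ] (α : ℝ) (hα : 0 < α)
    (zs : ℕ → CC) (z : CC) (y1s y2s : ℕ → CC) (y1 y2 : CC)
    (hy1s : ∀ n, y1s n ∈ Calpha α) (hy1 : y1 ∈ Calpha α)
    (hz : Tendsto zs atTop (nhds z)) (h1 : Tendsto y1s atTop (nhds y1))
    (h2 : Tendsto y2s atTop (nhds y2)) :
    Tendsto (fun n => ∫ t, (zs n t - y2s n t) / y1s n t ∂μ) atTop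
      (nhds (∫ t, (z t - y2 t) / y1 t ∂μ)) := by
  have hd : Tendsto (fun n => zs n - y2s n) atTop (nhds (z - y2)) := hz.sub h2
  obtain ⟨M, hM⟩ := (Metric.isBounded_range_of_tendsto _ hd).exists_norm_le
  have hM' : ∀ n, ‖zs n - y2s n‖ ≤ M := fun n => hM _ ⟨n, rfl⟩
  have ev : ∀ (f : ℕ → CC) (g : CC), Tendsto f atTop (nhds g) → ∀ t,
      Tendsto (fun n => f n t) atTop (nhds (g t)) := fun f g h t =>
    ((continuous_eval_const (F := CC) t).tendsto g).comp h
  refine tendsto_integral_of_dominated_convergence (fun _ => M / α) ?_ (integrable_const _) ?_ ?_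
  · intro n
    refine Continuous.aestronglyMeasurable ?_
    exact ((zs n).continuous.sub (y2s n).continuous).div (y1s n).continuous
      (fun t => (hα.trans_le (hy1s n t)).ne')
  · intro n
    refine Eventually.of_forall fun t => ?_
    have hp : α ≤ y1s n t := hy1s n t
    have hb : |zs n t - y2s n t| ≤ M := ((zs n - y2s n).norm_coe_le_norm t).trans (hM' n)
    rw [Real.norm_eq_abs, abs_div, abs_of_pos (hα.trans_le hp)]
    exact div_le_div₀ ((abs_nonneg _).trans hb) hb hα hp
  · refine Eventually.of_forall fun t => ?_
    have hne : y1 t ≠ 0 := ne_of_gt (hα.trans_le (hy1 t))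
    exact ((ev _ _ hz t).sub (ev _ _ h2 t)).div (ev _ _ h1 t) hne

/-- joint lower semicontinuity of
`J(z|y₁,y₂) = Λ*_{k̄}((z−y₂)/y₁)`. -/
theorem statement10 (α : ℝ) (hα : 0 < α) (kbar : UI → UI → ℝ) (hk : IsPSDKernel kbar)
    (zs : ℕ → CC) (z : CC) (y1s y2s : ℕ → CC) (y1 y2 : CC)
    (hy1s : ∀ n, y1s n ∈ Calpha α) (hy1 : y1 ∈ Calpha α)
    (hz : Tendsto zs atTop (nhds z)) (h1 : Tendsto y1s atTop (nhds y1))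
    (h2 : Tendsto y2s atTop (nhds y2)) :
    CramerK kbar (fun t => (z t - y2 t) / y1 t) ≤
      Filter.atTop.liminf fun n => CramerK kbar fun t => (zs n t - y2s n t) / y1s n t := by
  unfold CramerK
  refine iSup_le fun lam => ?_
  have ht : Tendsto (fun n => ENNReal.ofReal
      (pairSM lam (fun t => (zs n t - y2s n t) / y1s n t) - LamK kbar lam)) atTop
      (nhds (ENNReal.ofReal (pairSM lam (fun t => (z t - y2 t) / y1 t) - LamK kbar lam))) := by
    refine ENNReal.tendsto_ofReal (Tendsto.sub ?_ tendsto_const_nhds)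
    exact (aux_tendsto_integral _ α hα zs z y1s y2s y1 y2 hy1s hy1 hz h1 h2).sub
      (aux_tendsto_integral _ α hα zs z y1s y2s y1 y2 hy1s hy1 hz h1 h2)
  rw [← ht.liminf_eq]
  exact liminf_le_liminf (Eventually.of_forall fun n =>
    le_iSup (fun l : MeasureTheory.SignedMeasure UI => ENNReal.ofReal
      (pairSM l (fun t => (zs n t - y2s n t) / y1s n t) - LamK kbar l)) lam)

end
end
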